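/- arXiv:2001.04896 — 3 statements merged into one kernel-verified Lean document; each statement's English description precedes it below -/
import Mathlib

section
/- Let M be a compact C² d-dimensional submanifold of ℝ^D with reach τ(M) > 0, and let A ⊆ M be a finite set of cardinality n. Then the approximation rate ε(A) := sup{d(x,A) : x ∈ M} satisfies ε(A) ≥ c_d · τ(M) · n^{−1/d} for some constant c_d > 0 depending only on d. -/
open Metric Set

noncomputable section

variable {D d : ℕ}

/-- Radius of the smallest enclosing ball of a set: infimum over centers `z` of the
smallest `r` with `σ ⊆ closedBall z r`. -/
def sebRadius (σ : Set (EuclideanSpace ℝ (Fin D))) : ℝ :=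
  sInf {r : ℝ | ∃ z : EuclideanSpace ℝ (Fin D), σ ⊆ Metric.closedBall z r}

/-- The `t`-convex hull `Conv(t, A) = ⋃ {Conv σ : σ ⊆ A, r(σ) ≤ t}`. -/
def tConv (t : ℝ) (A : Set (EuclideanSpace ℝ (Fin D))) : Set (EuclideanSpace ℝ (Fin D)) :=
  ⋃ σ ∈ {σ : Set (EuclideanSpace ℝ (Fin D)) | σ ⊆ A ∧ sebRadius σ ≤ t}, convexHull ℝ σ

/-- The convexity defect function `h(t, A) = d_H(Conv(t,A), A)`. -/
def convDefect (t : ℝ) (A : Set (EuclideanSpace ℝ (Fin D))) : ℝ :=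
  Metric.hausdorffDist (tConv t A) A

/-- `Rad(A) = {r(σ) : σ ⊆ A}`. -/
def radSet (A : Set (EuclideanSpace ℝ (Fin D))) : Set ℝ :=
  {r : ℝ | ∃ σ ⊆ A, sebRadius σ = r}

/-- `t_λ(A) = inf {t ∈ Rad(A) : h(t,A) ≤ λ t}`. -/
def tSel (lam : ℝ) (A : Set (EuclideanSpace ℝ (Fin D))) : ℝ :=
  sInf {t : ℝ | t ∈ radSet A ∧ convDefect t A ≤ lam * t}

/-- `x` has a unique metric projection onto `M`. -/
def uniqueProj (M : Set (EuclideanSpace ℝ (Fin D))) (x : EuclideanSpace ℝ (Fin D)) : Prop :=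
  ∃! y, y ∈ M ∧ dist x y = Metric.infDist x M

/-- The reach of a set `M`: the largest `r` such that every point at distance `< r` from `M`
has a unique nearest point on `M`. -/
def reach (M : Set (EuclideanSpace ℝ (Fin D))) : ℝ :=
  sSup {r : ℝ | ∀ x : EuclideanSpace ℝ (Fin D), Metric.infDist x M < r → uniqueProj M x}

open Classical in
/-- The metric projection onto `M` (an arbitrary nearest point, when one exists). -/
def projOn (M : Set (EuclideanSpace ℝ (Fin D))) (x : EuclideanSpace ℝ (Fin D)) :
    EuclideanSpace ℝ (Fin D) :=
  if h : ∃ y, y ∈ M ∧ dist x y = Metric.infDist x M then h.choose else x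

/-- `t*(A) = inf {s < τ(M) : π_M(Conv(s,A)) = M}`. -/
def tStar (A M : Set (EuclideanSpace ℝ (Fin D))) : ℝ :=
  sInf {s : ℝ | s < reach M ∧ projOn M '' tConv s A = M}

/-- The approximation rate `ε(A) = sup {d(x, A) : x ∈ M}`. -/
def epsRate (M A : Set (EuclideanSpace ℝ (Fin D))) : ℝ :=
  sSup ((fun x => Metric.infDist x A) '' M)

/-- `M ⊆ ℝ^D` is a `d`-dimensional `C²` submanifold: around each of its points, `M` is the
image of an injective `C²` immersion from an open subset of `ℝ^d`. -/
def IsC2Submanifold (d : ℕ) (M : Set (EuclideanSpace ℝ (Fin D))) : Prop :=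
  ∀ x ∈ M, ∃ (φ : EuclideanSpace ℝ (Fin d) → EuclideanSpace ℝ (Fin D))
    (u : Set (EuclideanSpace ℝ (Fin d))) (V : Set (EuclideanSpace ℝ (Fin D))),
      IsOpen u ∧ (0 : EuclideanSpace ℝ (Fin d)) ∈ u ∧ φ 0 = x ∧ IsOpen V ∧ x ∈ V ∧
      ContDiffOn ℝ 2 φ u ∧ Set.InjOn φ u ∧ φ '' u = M ∩ V ∧
      ∀ y ∈ u, Function.Injective (fderiv ℝ φ y)

/-- The set of tangent vectors to `M` at `x`, realized as velocities of curves in `M`. -/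
def tangentVectorsAt (M : Set (EuclideanSpace ℝ (Fin D))) (x : EuclideanSpace ℝ (Fin D)) :
    Set (EuclideanSpace ℝ (Fin D)) :=
  {v | ∃ γ : ℝ → EuclideanSpace ℝ (Fin D), (∀ s, γ s ∈ M) ∧ γ 0 = x ∧ HasDerivAt γ v 0}

section ReachNormals

open Filter Topology
open scoped RealInnerProductSpace

/-- Every point at distance less than `τ` from `M` has a unique nearest point on `M`. -/
def HasUniqueProj {X : Type*} [MetricSpace X] (M : Set X) (τ : ℝ) : Prop :=
  ∀ x, infDist x M < τ → ∃! y, y ∈ M ∧ dist x y = infDist x M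

/-- The nearest point projection is continuous. -/
theorem HasUniqueProj.dist_lt {X : Type*} [MetricSpace X] {M : Set X} {τ : ℝ}
    (h : HasUniqueProj M τ) (hM : IsCompact M) {y z : X}
    (hy : infDist y M < τ) (hz : z ∈ M) (hyz : dist y z = infDist y M) {ε : ℝ} (hε : 0 < ε) :
    ∃ δ > 0, ∀ y', dist y' y < δ → ∀ z' ∈ M, dist y' z' = infDist y' M → dist z' z < ε := by
  have hC : IsCompact (M \ ball z ε) := hM.diff isOpen_ball
  rcases (M \ ball z ε).eq_empty_or_nonempty with he | hne
  · refine ⟨1, one_pos, fun y' _ z' hz' _ => ?_⟩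
    by_contra hcon
    have : z' ∈ M \ ball z ε := ⟨hz', hcon⟩
    simp [he] at this
  · obtain ⟨c, hc, hmin⟩ := hC.exists_isMinOn hne
      (continuous_const.dist continuous_id : Continuous fun w => dist y w).continuousOn
    have hlt : infDist y M < dist y c := by
      refine lt_of_le_of_ne (infDist_le_dist_of_mem hc.1) fun heq => hc.2 ?_
      rw [(h y hy).unique ⟨hc.1, heq.symm⟩ ⟨hz, hyz⟩]
      exact mem_ball_self hε
    refine ⟨(dist y c - infDist y M) / 2, by linarith, fun y' hy' z' hz' hyz' => ?_⟩
    by_contra hcon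
    have h1 : dist y c ≤ dist y z' := hmin (show z' ∈ M \ ball z ε from ⟨hz', hcon⟩)
    have h2 := infDist_le_infDist_add_dist (s := M) (x := y') (y := y)
    have h3 := dist_triangle y y' z'
    rw [dist_comm y y'] at h3
    linarith

variable {E : Type*} [NormedAddCommGroup E] [InnerProductSpace ℝ E] {M : Set E} {τ : ℝ}

/-- Directions `n` such that the balls of radius `τ` tangent to `n` at `q` do not meet `M`. -/
def reachNormals (M : Set E) (τ : ℝ) (q : E) : Set E :=
  {n | ∀ p ∈ M, ⟪p - q, n⟫ ≤ ‖n‖ * ‖p - q‖ ^ 2 / (2 * τ)}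

/-- Away from `M`, the distance function to `M` has slope one. -/
theorem HasUniqueProj.exists_slope (h : HasUniqueProj M τ) (hM : IsCompact M) {y : E}
    (hy0 : 0 < infDist y M) (hy : infDist y M < τ) {η ρ : ℝ} (hη : 0 < η) (hρ : 0 < ρ) :
    ∃ y', 0 < dist y' y ∧ dist y' y < ρ ∧
      infDist y M + (1 - η) * dist y' y ≤ infDist y' M := by
  obtain ⟨z, ⟨hz, hyz⟩, -⟩ := h y hy
  set δ := infDist y M with hδ
  have hε : 0 < η * δ / 2 := by positivity
  obtain ⟨s, hs, hcont⟩ := h.dist_lt hM hy hz hyz hε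
  obtain ⟨k, hk0, hk⟩ := exists_between (lt_min hs hρ)
  have hnorm : ‖y - z‖ = δ := by rw [← dist_eq_norm, hyz]
  have hd : dist (y + (k / δ) • (y - z)) y = k := by
    rw [dist_eq_norm, add_sub_cancel_left, norm_smul, hnorm, Real.norm_of_nonneg (by positivity)]
    field_simp
  refine ⟨y + (k / δ) • (y - z), by rw [hd]; exact hk0, by
    rw [hd]; exact hk.trans_le (min_le_right _ _), ?_⟩
  rw [hd]
  set y' := y + (k / δ) • (y - z) with hy'
  obtain ⟨z', hz', hyz'⟩ := hM.exists_infDist_eq_dist ⟨z, hz⟩ y'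
  have hzz := hcont y' (by rw [hd]; exact hk.trans_le (min_le_left _ _)) z' hz' hyz'.symm
  rw [hyz']
  set a := ‖y - z'‖ with ha
  have ha1 : δ ≤ a := by rw [ha, ← dist_eq_norm]; exact infDist_le_dist_of_mem hz'
  have ha2 : a ≤ δ + η * δ / 2 := by
    have := dist_triangle y z z'
    rw [hyz, dist_comm z z', dist_eq_norm y z'] at this
    linarith
  have hin : δ * (δ - η * δ / 2) ≤ ⟪y - z, y - z'⟫ := by
    have e : y - z' = (y - z) + (z - z') := by abel
    rw [e, inner_add_right, real_inner_self_eq_norm_sq, hnorm]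
    have h1 := abs_real_inner_le_norm (y - z) (z - z')
    rw [hnorm, ← dist_eq_norm, dist_comm z z'] at h1
    have h2 := (abs_le.1 h1).1
    nlinarith
  have hmul : a ^ 2 + k * (δ - η * δ / 2) ≤ dist y' z' * a := by
    have h1 := real_inner_le_norm (y' - z') (y - z')
    have e : y' - z' = (y - z') + (k / δ) • (y - z) := by rw [hy']; abel
    rw [← dist_eq_norm y' z'] at h1
    rw [e, inner_add_left, real_inner_smul_left, real_inner_self_eq_norm_sq] at h1
    have h2 : k / δ * (δ * (δ - η * δ / 2)) ≤ k / δ * ⟪y - z, y - z'⟫ := by gcongr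
    have h3 : k / δ * (δ * (δ - η * δ / 2)) = k * (δ - η * δ / 2) := by field_simp
    linarith
  by_contra! hcon
  have ha0 : 0 < a := hy0.trans_le ha1
  have h4 : dist y' z' * a < (δ + (1 - η) * k) * a := by gcongr
  have h5 : a * δ ≤ a ^ 2 := by nlinarith
  rcases le_total η 1 with h6 | h6
  · have : (1 - η) * k * a ≤ (1 - η) * k * (δ + η * δ / 2) := by
      have : 0 ≤ (1 - η) * k := mul_nonneg (by linarith) hk0.le
      gcongr
    have h7 : 0 < k * δ * η ^ 2 := by positivity
    nlinarith
  · have : (1 - η) * k * a ≤ (1 - η) * k * δ := by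
      have : 0 ≤ (η - 1) * k := mul_nonneg (by linarith) hk0.le
      nlinarith
    have h7 : 0 < k * δ * η := by positivity
    nlinarith

theorem HasUniqueProj.le_dist_of_ray [ProperSpace E] (h : HasUniqueProj M τ) (hM : IsCompact M)
    {y z : E} {s : ℝ} (hy0 : 0 < infDist y M) (hys : infDist y M < s) (hs : s < τ) (hz : z ∈ M)
    (hyz : dist y z = infDist y M) {p : E} (hp : p ∈ M) :
    s ≤ dist (z + (s / infDist y M) • (y - z)) p := by
  set δ := infDist y M with hδ
  have hr : 0 < s - δ := by linarith
  have hcd : Continuous fun w => infDist w M := continuous_infDist_pt M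
  have hsph : ∀ η : ℝ, 0 < η → η < 1 →
      ∃ w ∈ sphere y (s - δ), δ + (1 - η) * (s - δ) ≤ infDist w M := by
    intro η hη hη1
    obtain ⟨w, hw, hmax⟩ := (isCompact_closedBall y (s - δ)).exists_isMaxOn
      ⟨y, mem_closedBall_self hr.le⟩
      (f := fun w => infDist w M - (1 - η) * dist w y) (by fun_prop)
    have h0 : δ ≤ infDist w M - (1 - η) * dist w y := by
      have := hmax (mem_closedBall_self hr.le : y ∈ closedBall y (s - δ))
      simpa [hδ] using this
    rw [mem_closedBall] at hw
    have hwδ : 0 ≤ (1 - η) * dist w y := mul_nonneg (by linarith) dist_nonneg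
    have hws : dist w y = s - δ := by
      by_contra hne
      have hlt := lt_of_le_of_ne hw hne
      have hwτ : infDist w M < τ := by
        have := infDist_le_infDist_add_dist (s := M) (x := w) (y := y)
        linarith
      obtain ⟨w', h1, h2, h3⟩ := h.exists_slope hM (y := w) (by linarith) hwτ (half_pos hη)
        (sub_pos.2 hlt)
      have h4 : dist w' y ≤ dist w' w + dist w y := dist_triangle _ _ _
      have h5 : infDist w' M - (1 - η) * dist w' y ≤ infDist w M - (1 - η) * dist w y :=
        hmax (show w' ∈ closedBall y (s - δ) by rw [mem_closedBall]; linarith)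
      have h6 : (1 - η) * dist w' y ≤ (1 - η) * (dist w' w + dist w y) := by
        have : 0 ≤ 1 - η := by linarith
        gcongr
      have h7 : 0 < η * dist w' w := by positivity
      nlinarith
    exact ⟨w, hws, by rw [← hws]; linarith⟩
  obtain ⟨w₀, hw₀, -⟩ := hsph (1 / 2) (by norm_num) (by norm_num)
  obtain ⟨w, hw, hmax⟩ := (isCompact_sphere y (s - δ)).exists_isMaxOn ⟨w₀, hw₀⟩ hcd.continuousOn
  have hws : s ≤ infDist w M := by
    by_contra! hcon
    obtain ⟨η, h1, h2⟩ := exists_between (lt_min one_pos (div_pos (sub_pos.2 hcon) hr))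
    obtain ⟨w', hw', hle⟩ := hsph η h1 (h2.trans_le (min_le_left _ _))
    have h3 : infDist w' M ≤ infDist w M := hmax hw'
    have h4 := (lt_div_iff₀ hr).1 (h2.trans_le (min_le_right _ _))
    linarith
  have hwy : ‖w - y‖ = s - δ := by rw [← dist_eq_norm]; exact hw
  have hyz' : ‖y - z‖ = δ := by rw [← dist_eq_norm, hyz]
  have hwz : s ≤ ‖(w - y) + (y - z)‖ := by
    rw [sub_add_sub_cancel, ← dist_eq_norm]
    exact hws.trans (infDist_le_dist_of_mem hz)
  have hsame : δ • (w - y) = (s - δ) • (y - z) := by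
    have h1 := norm_add_sq_real (w - y) (y - z)
    have h2 := norm_sub_sq_real (δ • (w - y)) ((s - δ) • (y - z))
    rw [norm_smul, norm_smul, inner_smul_left, inner_smul_right, hwy, hyz',
      Real.norm_of_nonneg hy0.le, Real.norm_of_nonneg hr.le] at h2
    rw [hwy, hyz'] at h1
    have h3 : s ^ 2 ≤ ‖w - y + (y - z)‖ ^ 2 := by gcongr; linarith
    have h4 : (s - δ) * δ ≤ ⟪w - y, y - z⟫ := by nlinarith
    have h5 : δ * (s - δ) * ((s - δ) * δ) ≤ δ * (s - δ) * ⟪w - y, y - z⟫ := by gcongr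
    have h6 : ‖δ • (w - y) - (s - δ) • (y - z)‖ ^ 2 ≤ 0 := by
      simp only [conj_trivial] at h2
      nlinarith
    exact sub_eq_zero.1 (norm_eq_zero.1 (pow_eq_zero_iff two_ne_zero |>.1
      (le_antisymm h6 (sq_nonneg _))))
  have hw_eq : z + (s / δ) • (y - z) = w := by
    have : w - y = ((s - δ) / δ) • (y - z) := by
      rw [div_eq_inv_mul, mul_smul, ← hsame, smul_smul, inv_mul_cancel₀ hy0.ne', one_smul]
    have e : (s / δ) = (s - δ) / δ + 1 := by field_simp; ring
    rw [e, add_smul, ← this]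
    simp
  rw [hw_eq]
  exact hws.trans (infDist_le_dist_of_mem hp)

theorem HasUniqueProj.sub_mem_reachNormals [ProperSpace E] (h : HasUniqueProj M τ)
    (hM : IsCompact M) {y z : E} (hy : infDist y M < τ) (hz : z ∈ M)
    (hyz : dist y z = infDist y M) : y - z ∈ reachNormals M τ z := by
  intro p hp
  rw [← dist_eq_norm y z, hyz]
  rcases eq_or_lt_of_le (infDist_nonneg (x := y) (s := M)) with h0 | h0
  · have : y = z := dist_eq_zero.1 (by rw [hyz, ← h0])
    rw [← h0]
    simp [this]
  set δ := infDist y M with hδ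
  have hτ : 0 < τ := h0.trans hy
  have key : ∀ s, δ < s → s < τ → 2 * s * ⟪p - z, y - z⟫ ≤ δ * ‖p - z‖ ^ 2 := by
    intro s h1 h2
    have h3 := h.le_dist_of_ray hM h0 h1 h2 hz hyz hp
    have hs : 0 < s := h0.trans h1
    rw [← hδ, dist_comm, dist_eq_norm, ← sub_sub] at h3
    have h4 := norm_sub_sq_real (p - z) ((s / δ) • (y - z))
    rw [norm_smul, inner_smul_right, ← dist_eq_norm y z, hyz, Real.norm_of_nonneg (by positivity),
      div_mul_cancel₀ _ h0.ne'] at h4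
    have h5 : s ^ 2 ≤ ‖p - z - (s / δ) • (y - z)‖ ^ 2 := by gcongr
    have h6 : 2 * (s / δ * ⟪p - z, y - z⟫) ≤ ‖p - z‖ ^ 2 := by linarith
    have h7 : δ * (2 * (s / δ * ⟪p - z, y - z⟫)) ≤ δ * ‖p - z‖ ^ 2 := by gcongr
    have h8 : δ * (2 * (s / δ * ⟪p - z, y - z⟫)) = 2 * s * ⟪p - z, y - z⟫ := by field_simp
    linarith
  have hlim : 2 * τ * ⟪p - z, y - z⟫ ≤ δ * ‖p - z‖ ^ 2 := by
    have ht : Tendsto (fun s : ℝ => 2 * s * ⟪p - z, y - z⟫) (𝓝[<] τ)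
        (𝓝 (2 * τ * ⟪p - z, y - z⟫)) :=
      (Continuous.tendsto (by fun_prop) τ).mono_left nhdsWithin_le_nhds
    refine le_of_tendsto ht ?_
    filter_upwards [Ioo_mem_nhdsLT hy] with s hs using key s hs.1 hs.2
  rw [le_div_iff₀ (by positivity)]
  linarith

end ReachNormals

section NormalVectors

open Filter Topology
open scoped RealInnerProductSpace

/-- The points where an injective parametrization of part of a compact set is open onto its image
are dense, by Baire's theorem. -/
theorem exists_nhdsWithin_le_map_nhds {X Y : Type*} [MetricSpace X] [NormedAddCommGroup Y]
    [ProperSpace Y] {M : Set X} (hM : IsCompact M) {φ : Y → X} {u : Set Y} {V : Set X}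
    (hu : IsOpen u) (hV : IsOpen V) (hφ : ContinuousOn φ u)
    (hinj : InjOn φ u) (himg : φ '' u = M ∩ V) {q : X} (hq : q ∈ M ∩ V) {ρ : ℝ} (hρ : 0 < ρ) :
    ∃ a ∈ u, dist (φ a) q < ρ ∧ 𝓝[M] (φ a) ≤ map φ (𝓝 a) := by
  obtain ⟨G, hGc, hGu, hGU, -⟩ := hu.exists_iUnion_isClosed
  let Q : ℕ × ℕ → Set Y := fun i => G i.1 ∩ closedBall 0 i.2
  have hQc : ∀ i, IsCompact (Q i) := fun i => (isCompact_closedBall _ _).inter_left (hGc _)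
  have hQu : ∀ i, Q i ⊆ u := fun i => inter_subset_left.trans (hGu _)
  have hcomp : ∀ s ⊆ u, IsCompact s → IsCompact (φ '' s) := fun s hs hc =>
    hc.image_of_continuousOn (hφ.mono hs)
  have : CompactSpace M := isCompact_iff_compactSpace.1 hM
  let f : Option (ℕ × ℕ) → Set M := fun i =>
    i.elim (Subtype.val ⁻¹' Vᶜ) fun j => Subtype.val ⁻¹' (φ '' Q j)
  have hfc : ∀ i, IsClosed (f i) := by
    rintro (_ | j)
    · exact hV.isClosed_compl.preimage continuous_subtype_val
    · exact (hcomp _ (hQu j) (hQc j)).isClosed.preimage continuous_subtype_val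
  have hfU : ⋃ i, f i = univ := by
    refine eq_univ_of_forall fun x => mem_iUnion.2 ?_
    by_cases hx : (x : X) ∈ V
    · obtain ⟨y, hy, hyx⟩ : (x : X) ∈ φ '' u := himg ▸ ⟨x.2, hx⟩
      obtain ⟨i, hi⟩ := mem_iUnion.1 (hGU ▸ hy : y ∈ ⋃ i, G i)
      obtain ⟨j, hj⟩ := exists_nat_ge ‖y‖
      exact ⟨some (i, j), y, ⟨hi, by simpa using hj⟩, hyx⟩
    · exact ⟨none, hx⟩
  have hdense := dense_iUnion_interior_of_closed hfc hfU
  obtain ⟨x, hx, hxi⟩ := hdense.inter_open_nonempty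
    (Subtype.val ⁻¹' (V ∩ ball q ρ)) ((hV.inter isOpen_ball).preimage continuous_subtype_val)
    ⟨⟨q, hq.1⟩, hq.2, mem_ball_self hρ⟩
  obtain ⟨i, hi⟩ := mem_iUnion.1 hxi
  rcases i with _ | j
  · exact absurd hx.1 (interior_subset hi)
  obtain ⟨a, ha, hax⟩ : (x : X) ∈ φ '' Q j :=
    (interior_subset hi : x ∈ f (some j))
  refine ⟨a, hQu j ha, by rw [hax]; exact hx.2, ?_⟩
  intro U hU
  obtain ⟨U', hU'U, hU'o, haU'⟩ := _root_.mem_nhds_iff.1 (mem_map.1 hU)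
  have hcl : IsClosed (φ '' (Q j \ U')) :=
    (hcomp _ (sdiff_subset.trans (hQu j)) ((hQc j).diff hU'o)).isClosed
  have hnot : φ a ∉ φ '' (Q j \ U') := by
    rintro ⟨b, hb, hba⟩
    exact hb.2 (hinj (hQu j hb.1) (hQu j ha) hba ▸ haU')
  have h1 : φ '' Q j ∈ 𝓝[M] (φ a) := by
    have h2 : f (some j) ∈ 𝓝 x := mem_interior_iff_mem_nhds.1 hi
    rw [hax]
    exact preimage_coe_mem_nhds_subtype.1 h2
  filter_upwards [h1, mem_nhdsWithin_of_mem_nhds (hcl.isOpen_compl.mem_nhds hnot)] with p hp hp'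
  obtain ⟨b, hb, rfl⟩ := hp
  by_contra hcon
  exact hp' ⟨b, ⟨hb, fun hbU => hcon (hU'U hbU)⟩, rfl⟩

variable {E : Type*} [NormedAddCommGroup E] [InnerProductSpace ℝ E] {M : Set E} {τ : ℝ}
variable {F : Type*} [NormedAddCommGroup F] [NormedSpace ℝ F]

theorem smul_mem_reachNormals_iff {q n : E} {t : ℝ} (ht : 0 < t) :
    t • n ∈ reachNormals M τ q ↔ n ∈ reachNormals M τ q := by
  simp only [reachNormals, mem_ofPred_eq, inner_smul_right, norm_smul, Real.norm_of_nonneg ht.le,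
    mul_assoc, mul_div_assoc, mul_le_mul_iff_right₀ ht]

theorem inner_eq_zero_of_mem_reachNormals {φ : F → E} {L : F →L[ℝ] E} {a : F}
    (hφ : HasFDerivAt φ L a) (hφM : ∀ᶠ y in 𝓝 a, φ y ∈ M) {n : E}
    (hn : n ∈ reachNormals M τ (φ a)) (w : F) : ⟪L w, n⟫ = 0 := by
  have hsub : HasFDerivAt (fun y => φ y - φ a) L a := hφ.sub_const _
  have h1 := (hsub.inner ℝ (hasFDerivAt_const n a)).sub
    ((hsub.norm_sq).const_mul (‖n‖ / (2 * τ)))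
  have hmax : IsLocalMax (fun y => ⟪φ y - φ a, n⟫ - ‖n‖ / (2 * τ) * ‖φ y - φ a‖ ^ 2) a := by
    filter_upwards [hφM] with y hy
    have := hn _ hy
    have e : ‖n‖ / (2 * τ) * ‖φ y - φ a‖ ^ 2 = ‖n‖ * ‖φ y - φ a‖ ^ 2 / (2 * τ) := by ring
    simp only [sub_self, inner_zero_left, norm_zero]
    rw [e]
    simpa using this
  have h2 := congrArg (fun l => l w) (hmax.hasFDerivAt_eq_zero h1)
  simpa using h2

/-- A `C²` map has a quadratic first order Taylor remainder. -/
theorem ContDiffAt.exists_taylor_bound {φ : F → E} {a : F} (hφ : ContDiffAt ℝ 2 φ a) :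
    ∃ C > 0, ∀ᶠ y in 𝓝 a, ‖φ y - φ a - fderiv ℝ φ a (y - a)‖ ≤ C * ‖y - a‖ ^ 2 := by
  have h1 : DifferentiableAt ℝ (fderiv ℝ φ) a :=
    (hφ.fderiv_right (m := 1) (by norm_num)).differentiableAt (by norm_num)
  obtain ⟨C, hC, hb⟩ := h1.hasFDerivAt.isBigO_sub.exists_pos
  have h2 : ∀ᶠ y in 𝓝 a, DifferentiableAt ℝ φ y :=
    (hφ.eventually (by simp)).mono fun y hy => hy.differentiableAt (by norm_num)
  obtain ⟨r, hr, hball⟩ := Metric.eventually_nhds_iff_ball.1 (hb.bound.and h2)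
  refine ⟨C, hC, ?_⟩
  filter_upwards [ball_mem_nhds a hr] with y hy
  have hsub : closedBall a ‖y - a‖ ⊆ ball a r := by
    apply closedBall_subset_ball
    rwa [← dist_eq_norm]
  have := (convex_closedBall a ‖y - a‖).norm_image_sub_le_of_norm_fderiv_le' (𝕜 := ℝ) (f := φ)
    (φ := fderiv ℝ φ a) (C := C * ‖y - a‖) (fun x hx => (hball x (hsub hx)).2)
    (fun x hx => ((hball x (hsub hx)).1).trans (by
      rw [mem_closedBall, dist_eq_norm] at hx
      gcongr))
    (mem_closedBall_self (norm_nonneg _)) (show y ∈ _ by rw [mem_closedBall, dist_eq_norm])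
  calc _ ≤ _ := this
    _ = _ := by ring

/-- At a point near which `M` is the image under a `C²` immersion of small neighbourhoods, every
vector normal to the immersion is normal in the sense of the reach. -/
theorem HasUniqueProj.mem_reachNormals_of_chart [ProperSpace E] [FiniteDimensional ℝ F]
    (h : HasUniqueProj M τ) (hτ : 0 < τ) (hM : IsCompact M) {φ : F → E} {a : F}
    (hφ : ContDiffAt ℝ 2 φ a) (hinj : Function.Injective (fderiv ℝ φ a)) (haM : φ a ∈ M)
    (hloc : 𝓝[M] (φ a) ≤ map φ (𝓝 a)) {n : E} (hn : ∀ w, ⟪fderiv ℝ φ a w, n⟫ = 0) :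
    n ∈ reachNormals M τ (φ a) := by
  obtain ⟨C, hC, hT⟩ := hφ.exists_taylor_bound
  obtain ⟨K, hK, hanti⟩ := (fderiv ℝ φ a).toLinearMap.exists_antilipschitzWith
    (LinearMap.ker_eq_bot.2 hinj)
  have hK' : 0 < (K : ℝ) := hK
  have hlow : ∀ w, ‖w‖ ≤ K * ‖fderiv ℝ φ a w‖ := fun w => by
    simpa using hanti.le_mul_dist w 0
  have hquad : ∀ᶠ y in 𝓝 a, ⟪φ y - φ a, n⟫ ≤ C * (2 * K) ^ 2 * ‖n‖ * ‖φ y - φ a‖ ^ 2 := by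
    have hsmall : ∀ᶠ y in 𝓝 a, ‖y - a‖ < 1 / (2 * K * C) := by
      filter_upwards [ball_mem_nhds a (show 0 < 1 / (2 * K * C) by positivity)] with y hy
      rwa [← dist_eq_norm]
    filter_upwards [hT, hsmall] with y hy hs
    have h1 : ‖y - a‖ ≤ 2 * K * ‖φ y - φ a‖ := by
      have h2 := hlow (y - a)
      have h3 := norm_sub_norm_le (fderiv ℝ φ a (y - a)) (φ y - φ a)
      rw [norm_sub_rev (fderiv ℝ φ a (y - a))] at h3
      have h4 := (lt_div_iff₀ (by positivity)).1 hs
      have h5 : K * ‖fderiv ℝ φ a (y - a)‖ ≤ K * (‖φ y - φ a‖ + C * ‖y - a‖ ^ 2) := by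
        gcongr; linarith
      nlinarith [norm_nonneg (y - a)]
    have h2 : ⟪φ y - φ a, n⟫ = ⟪φ y - φ a - fderiv ℝ φ a (y - a), n⟫ := by
      rw [inner_sub_left (φ y - φ a), hn, sub_zero]
    rw [h2]
    calc _ ≤ _ := real_inner_le_norm _ _
      _ ≤ C * (2 * K * ‖φ y - φ a‖) ^ 2 * ‖n‖ := by
        gcongr
        exact hy.trans (by gcongr)
      _ = _ := by ring
  obtain ⟨ρ, hρ, hnear⟩ := Metric.mem_nhdsWithin_iff.1 (hloc (show
    {p | ⟪p - φ a, n⟫ ≤ C * (2 * K) ^ 2 * ‖n‖ * ‖p - φ a‖ ^ 2} ∈ map φ (𝓝 a) from hquad))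
  set B := C * (2 * K) ^ 2 * ‖n‖ + ‖n‖ / ρ + 1 with hB
  have hB0 : 0 < B := by positivity
  have hglob : ∀ p ∈ M, ⟪p - φ a, n⟫ ≤ B * ‖p - φ a‖ ^ 2 := by
    intro p hp
    rcases lt_or_ge (dist p (φ a)) ρ with hlt | hge
    · have : ⟪p - φ a, n⟫ ≤ C * (2 * K) ^ 2 * ‖n‖ * ‖p - φ a‖ ^ 2 := hnear ⟨hlt, hp⟩
      refine this.trans ?_
      have : C * (2 * K) ^ 2 * ‖n‖ ≤ B := by
        have : 0 ≤ ‖n‖ / ρ := by positivity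
        linarith
      gcongr
    · rw [dist_eq_norm] at hge
      have h1 : ‖p - φ a‖ ≤ ‖p - φ a‖ ^ 2 / ρ := by
        rw [le_div_iff₀ hρ, sq]; gcongr
      calc _ ≤ _ := real_inner_le_norm _ _
        _ ≤ ‖p - φ a‖ ^ 2 / ρ * ‖n‖ := by gcongr
        _ = ‖n‖ / ρ * ‖p - φ a‖ ^ 2 := by ring
        _ ≤ _ := by
          have : 0 ≤ C * (2 * K) ^ 2 * ‖n‖ := by positivity
          gcongr
          linarith
  obtain ⟨t, ht0, ht⟩ := exists_between
    (lt_min (show 0 < 1 / (2 * B) by positivity) (show 0 < τ / (‖n‖ + 1) by positivity))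
  have ht1 := (lt_div_iff₀ (by positivity)).1 (ht.trans_le (min_le_left _ _))
  have ht2 := (lt_div_iff₀ (by positivity)).1 (ht.trans_le (min_le_right _ _))
  have hdist : dist (φ a + t • n) (φ a) = t * ‖n‖ := by
    rw [dist_eq_norm, add_sub_cancel_left, norm_smul, Real.norm_of_nonneg ht0.le]
  have hinf : dist (φ a + t • n) (φ a) = infDist (φ a + t • n) M := by
    refine le_antisymm ((le_infDist ⟨_, haM⟩).2 fun p hp => ?_) (infDist_le_dist_of_mem haM)
    rw [hdist, dist_comm, dist_eq_norm, ← sub_sub]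
    refine (pow_le_pow_iff_left₀ (by positivity) (norm_nonneg _) two_ne_zero).1 ?_
    rw [norm_sub_sq_real, inner_smul_right, norm_smul, Real.norm_of_nonneg ht0.le]
    have h1 : t * ⟪p - φ a, n⟫ ≤ t * (B * ‖p - φ a‖ ^ 2) := by gcongr; exact hglob p hp
    nlinarith [sq_nonneg ‖p - φ a‖]
  have hmem := h.sub_mem_reachNormals hM (by rw [← hinf, hdist]; nlinarith [norm_nonneg n]) haM hinf
  rwa [add_sub_cancel_left, smul_mem_reachNormals_iff ht0] at hmem

/-- Semicontinuity of the normal cone: if `M` has `m`-dimensional spaces of normals arbitrarily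
close to `q`, and the normals at `q` lie in an `m`-dimensional space, then they fill it. -/
theorem subset_reachNormals_of_approx [FiniteDimensional ℝ E] {m : ℕ} {q : E}
    {W : Submodule ℝ E} (hW : Module.finrank ℝ W = m) (hqW : reachNormals M τ q ⊆ W)
    (happ : ∀ ρ > 0, ∃ p, dist p q < ρ ∧
      ∃ b : Fin m → E, Orthonormal ℝ b ∧ ∀ c : Fin m → ℝ, ∑ i, c i • b i ∈ reachNormals M τ p) :
    (W : Set E) ⊆ reachNormals M τ q := by
  choose p hp b hb hbN using fun k : ℕ => happ (1 / ((k : ℝ) + 1)) (by positivity)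
  have hpq : Tendsto p atTop (𝓝 q) := tendsto_iff_dist_tendsto_zero.2
    (squeeze_zero (fun _ => dist_nonneg) (fun k => (hp k).le) tendsto_one_div_add_atTop_nhds_zero_nat)
  obtain ⟨b₀, -, ψ, hψ, hlim⟩ := (isCompact_closedBall (0 : Fin m → E) 1).tendsto_subseq
    (x := b) fun k => by
      rw [mem_closedBall_zero_iff, pi_norm_le_iff_of_nonneg zero_le_one]
      exact fun i => ((hb k).1 i).le
  have hlim' := tendsto_pi_nhds.1 hlim
  have hpψ := hpq.comp hψ.tendsto_atTop
  have hb₀ : Orthonormal ℝ b₀ := by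
    rw [orthonormal_iff_ite]
    intro i j
    refine tendsto_nhds_unique ((hlim' i).inner (hlim' j)) ?_
    simp only [Function.comp_apply, fun k => orthonormal_iff_ite.1 (hb (ψ k)) i j]
    exact tendsto_const_nhds
  have hN : ∀ c : Fin m → ℝ, ∑ i, c i • b₀ i ∈ reachNormals M τ q := by
    intro c r hr
    have hs : Tendsto (fun k => ∑ i, c i • b (ψ k) i) atTop (𝓝 (∑ i, c i • b₀ i)) :=
      tendsto_finsetSum _ fun i _ => (hlim' i).const_smul (c i)
    have hd : Tendsto (fun k => r - p (ψ k)) atTop (𝓝 (r - q)) := hpψ.const_sub r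
    exact le_of_tendsto_of_tendsto' (hd.inner hs)
      ((hs.norm.mul (hd.norm.pow 2)).div_const _) fun k => hbN (ψ k) c r hr
  have hle : Submodule.span ℝ (range b₀) ≤ W := by
    rw [Submodule.span_le]
    rintro _ ⟨i, rfl⟩
    have := hN (Pi.single i 1)
    simp only [Pi.single_apply, ite_smul, one_smul, zero_smul, Finset.sum_ite_eq',
      Finset.mem_univ, if_true] at this
    exact hqW this
  have heq : Submodule.span ℝ (range b₀) = W := by
    refine Submodule.eq_of_le_of_finrank_eq hle ?_
    rw [finrank_span_eq_card hb₀.linearIndependent, hW, Fintype.card_fin]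
  intro n hn
  rw [← heq] at hn
  obtain ⟨c, rfl⟩ := (Submodule.mem_span_range_iff_exists_fun ℝ).1 hn
  exact hN c

end NormalVectors

section TangentVectors

open Filter Topology
open scoped RealInnerProductSpace

variable {E : Type*} [NormedAddCommGroup E] [InnerProductSpace ℝ E] {M : Set E} {τ : ℝ}
variable {F : Type*} [NormedAddCommGroup F] [NormedSpace ℝ F]

/-- Upper bound for the right derivative of the distance to `M` along a line. -/
theorem eventually_infDist_line_lt {q v z : E} {t r : ℝ} (hv : ‖v‖ = 1) (hz : z ∈ M)
    (hqz : dist (q + t • v) z = infDist (q + t • v) M) (hpos : 0 < infDist (q + t • v) M)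
    (hr : ⟪q + t • v - z, v⟫ / infDist (q + t • v) M < r) :
    ∀ᶠ s in 𝓝[>] t, infDist (q + s • v) M < infDist (q + t • v) M + r * (s - t) := by
  set δ := infDist (q + t • v) M with hδ
  set c := ⟪q + t • v - z, v⟫ / δ with hc
  have hcδ : ⟪q + t • v - z, v⟫ = c * δ := by rw [hc, div_mul_cancel₀ _ hpos.ne']
  have hnorm : ‖q + t • v - z‖ = δ := by rw [← dist_eq_norm, hqz]
  have hc1 : |c| ≤ 1 := by
    have h1 := abs_real_inner_le_norm (q + t • v - z) v
    rw [hcδ, hnorm, hv, abs_mul, abs_of_pos hpos] at h1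
    exact le_of_mul_le_mul_right (by linarith) hpos
  have hm : 0 < min δ (2 * δ * (r - c)) := lt_min hpos (by nlinarith)
  filter_upwards [Ioo_mem_nhdsGT (show t < t + min δ (2 * δ * (r - c)) by linarith)] with s hs
  have hh : 0 < s - t := by linarith [hs.1]
  have h1 : s - t < δ := by linarith [hs.2, min_le_left δ (2 * δ * (r - c))]
  have h2 : s - t < 2 * δ * (r - c) := by linarith [hs.2, min_le_right δ (2 * δ * (r - c))]
  have hbase : 0 ≤ δ + (s - t) * c := by
    have := (abs_le.1 hc1).1
    nlinarith
  have hle : dist (q + s • v) z ≤ δ + (s - t) * c + (s - t) ^ 2 / (2 * δ) := by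
    have e : q + s • v - z = (q + t • v - z) + (s - t) • v := by rw [sub_smul]; abel
    rw [dist_eq_norm, e]
    refine (pow_le_pow_iff_left₀ (norm_nonneg _) (by positivity) two_ne_zero).1 ?_
    rw [norm_add_sq_real, inner_smul_right, norm_smul, hv, hcδ, hnorm,
      Real.norm_of_nonneg hh.le]
    have e2 : (δ + (s - t) * c + (s - t) ^ 2 / (2 * δ)) ^ 2
        = δ ^ 2 + 2 * ((s - t) * (c * δ)) + (s - t) ^ 2
          + ((s - t) * c + (s - t) ^ 2 / (2 * δ)) ^ 2 := by
      field_simp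
      ring
    rw [e2]
    nlinarith [sq_nonneg ((s - t) * c + (s - t) ^ 2 / (2 * δ))]
  have h3 : (s - t) ^ 2 / (2 * δ) < (s - t) * (r - c) := by
    rw [div_lt_iff₀ (by positivity)]
    nlinarith
  have := infDist_le_dist_of_mem hz (x := q + s • v)
  linarith

/-- If all normals of `M` are two-sided, then tangent lines stay quadratically close to `M`. -/
theorem HasUniqueProj.infDist_tangent_le [ProperSpace E] (h : HasUniqueProj M τ) (hτ : 0 < τ)
    (hM : IsCompact M) (hsymm : ∀ z ∈ M, ∀ n ∈ reachNormals M τ z, -n ∈ reachNormals M τ z)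
    {q v : E} (hq : q ∈ M) (hv : ‖v‖ = 1)
    (htan : ∀ η > 0, ∀ᶠ t : ℝ in 𝓝[>] 0, infDist (q + t • v) M ≤ η * t)
    {t : ℝ} (ht : 0 < t) (htτ : t < τ) : infDist (q + t • v) M ≤ 3 / τ * t ^ 2 := by
  choose z hzM hzd using fun s : ℝ => hM.exists_infDist_eq_dist ⟨q, hq⟩ (q + s • v)
  have hle : ∀ s, 0 ≤ s → infDist (q + s • v) M ≤ s := fun s hs => by
    simpa [dist_eq_norm, norm_smul, hv, abs_of_nonneg hs] using
      infDist_le_dist_of_mem hq (x := q + s • v)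
  refine le_of_forall_pos_le_add fun ε hε => ?_
  have hη : 0 < ε / t := by positivity
  obtain ⟨a, haη, ha0, hat⟩ := ((htan _ hη).and (Ioo_mem_nhdsGT ht)).exists
  have key := image_le_of_liminf_slope_right_lt_deriv_boundary
    (f := fun s => infDist (q + s • v) M)
    (f' := fun s => if infDist (q + s • v) M = 0 then 1 else
      ⟪q + s • v - z s, v⟫ / infDist (q + s • v) M) (a := a) (b := t)
    (B := fun s => ε / t * s + 3 / τ * s ^ 2) (B' := fun s => ε / t + 3 / τ * (2 * s))
    ((continuous_infDist_pt M).comp (by fun_prop)).continuousOn ?_ ?_ ?_ ?_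
    (right_mem_Icc.2 hat.le)
  · calc _ ≤ _ := key
      _ = _ := by field_simp; ring
  · intro s hs r hr
    suffices hev : ∀ᶠ s' in 𝓝[>] s, infDist (q + s' • v) M < infDist (q + s • v) M + r * (s' - s) by
      refine (hev.and self_mem_nhdsWithin).frequently.mono fun s' hs' => ?_
      rw [slope_def_field, div_lt_iff₀ (sub_pos.2 hs'.2)]
      linarith [hs'.1]
    split_ifs at hr with h0
    · filter_upwards [self_mem_nhdsWithin] with s' hs'
      have hs'' : 0 < s' - s := sub_pos.2 hs'
      have h1 := infDist_le_infDist_add_dist (s := M) (x := q + s' • v) (y := q + s • v)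
      rw [dist_eq_norm, add_sub_add_left_eq_sub, ← sub_smul, norm_smul, hv,
        Real.norm_of_nonneg hs''.le] at h1
      nlinarith
    · exact eventually_infDist_line_lt hv (hzM s) (hzd s).symm
        (lt_of_le_of_ne infDist_nonneg (Ne.symm h0)) hr
  · have : 0 ≤ 3 / τ * a ^ 2 := by positivity
    linarith
  · intro s
    have := ((hasDerivAt_id s).const_mul (ε / t)).add (((hasDerivAt_pow 2 s)).const_mul (3 / τ))
    refine this.congr_deriv ?_
    simp
  · intro s hs heq
    have hs0 : 0 < s := ha0.trans_le hs.1
    change infDist (q + s • v) M = ε / t * s + 3 / τ * s ^ 2 at heq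
    change (if infDist (q + s • v) M = 0 then 1 else
      ⟪q + s • v - z s, v⟫ / infDist (q + s • v) M) < ε / t + 3 / τ * (2 * s)
    set δ := infDist (q + s • v) M with hδ
    have hδ0 : 0 < δ := by rw [heq]; positivity
    have hδs : δ ≤ s := hle s hs0.le
    simp only [hδ0.ne', if_false]
    set c := ⟪q + s • v - z s, v⟫ / δ with hc
    have hcδ : ⟪q + s • v - z s, v⟫ = c * δ := by rw [hc, div_mul_cancel₀ _ hδ0.ne']
    have hnorm : ‖q + s • v - z s‖ = δ := by rw [← dist_eq_norm, ← hzd]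
    have hc1 : |c| ≤ 1 := by
      have h1 := abs_real_inner_le_norm (q + s • v - z s) v
      rw [hcδ, hnorm, hv, abs_mul, abs_of_pos hδ0] at h1
      exact le_of_mul_le_mul_right (by linarith) hδ0
    have hN := h.sub_mem_reachNormals hM (by linarith [hs.2]) (hzM s) (hzd s).symm
    have hN' := hsymm _ (hzM s) _ hN q hq
    have e : q - z s = (q + s • v - z s) - s • v := by abel
    rw [inner_neg_right, norm_neg, hnorm, e, inner_sub_left, real_inner_self_eq_norm_sq, hnorm,
      inner_smul_left, real_inner_comm, hcδ, norm_sub_sq_real, hnorm, inner_smul_right, hcδ,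
      norm_smul, hv, Real.norm_of_nonneg hs0.le, le_div_iff₀ (by positivity)] at hN'
    simp only [conj_trivial] at hN'
    have hmain : (s * c - δ) * (2 * τ) ≤ 4 * s ^ 2 := by
      have h1 : δ * ((s * c - δ) * (2 * τ)) ≤ δ * (δ ^ 2 - 2 * (s * (c * δ)) + (s * 1) ^ 2) := by
        linarith
      have h2 := le_of_mul_le_mul_left h1 hδ0
      have h3 := (abs_le.1 hc1).1
      nlinarith [mul_pos hs0 hδ0]
    have h4 : s * c < s * (ε / t + 3 / τ * (2 * s)) := by
      have h5 : s * c - δ ≤ 2 / τ * s ^ 2 := by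
        rw [div_mul_eq_mul_div, le_div_iff₀ hτ]
        linarith
      have h6 : 0 < 1 / τ * s ^ 2 := by positivity
      have e3 : 3 / τ * s ^ 2 = 3 * (1 / τ * s ^ 2) := by ring
      have e2 : 2 / τ * s ^ 2 = 2 * (1 / τ * s ^ 2) := by ring
      have e6 : s * (ε / t + 3 / τ * (2 * s)) = ε / t * s + 6 * (1 / τ * s ^ 2) := by ring
      rw [e6]
      rw [e3] at heq
      rw [e2] at h5
      linarith
    exact lt_of_mul_lt_mul_left h4 hs0.le

/-- A direction normal to `M` at `x` is not tangent to `M` at a point close to `x`. -/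
theorem HasUniqueProj.notMem_reachNormals_of_tangent [ProperSpace E] (h : HasUniqueProj M τ)
    (hτ : 0 < τ) (hM : IsCompact M)
    (hsymm : ∀ z ∈ M, ∀ n ∈ reachNormals M τ z, -n ∈ reachNormals M τ z)
    {x q v : E} (hq : q ∈ M) (hv : ‖v‖ = 1)
    (htan : ∀ η > 0, ∀ᶠ t : ℝ in 𝓝[>] 0, infDist (q + t • v) M ≤ η * t)
    (hqx : dist q x ≤ τ / 100) : v ∉ reachNormals M τ x := by
  intro hvN
  have hd := h.infDist_tangent_le hτ hM hsymm hq hv htan (t := τ / 8) (by positivity) (by linarith)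
  obtain ⟨z, hz, hzd⟩ := hM.exists_infDist_eq_dist ⟨q, hq⟩ (q + (τ / 8) • v)
  have e : 3 / τ * (τ / 8) ^ 2 = 3 * τ / 64 := by field_simp; norm_num
  rw [hzd, e, dist_comm, dist_eq_norm] at hd
  rw [dist_eq_norm] at hqx
  have h1 := hvN z hz
  have e2 : z - x = (z - (q + (τ / 8) • v)) + (q - x) + (τ / 8) • v := by abel
  have h2 := (abs_le.1 (abs_real_inner_le_norm (z - (q + (τ / 8) • v)) v)).1
  have h3 := (abs_le.1 (abs_real_inner_le_norm (q - x) v)).1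
  have h4 : ‖z - x‖ ≤ 3 * τ / 64 + τ / 100 + τ / 8 := by
    rw [e2]
    refine norm_add₃_le.trans ?_
    rw [norm_smul, hv, Real.norm_of_nonneg (by positivity)]
    linarith
  have h5 : ‖z - x‖ ^ 2 ≤ (3 * τ / 64 + τ / 100 + τ / 8) ^ 2 := by gcongr
  rw [le_div_iff₀ (by positivity), hv, e2, inner_add_left, inner_add_left, inner_smul_left,
    real_inner_self_eq_norm_sq, hv, ← e2] at h1
  simp only [conj_trivial, hv, mul_one] at *
  nlinarith [mul_pos hτ hτ]

/-- The image of a parametrization is close to its tangent lines. -/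
theorem HasFDerivAt.eventually_infDist_tangent_le {φ : F → E} {L : F →L[ℝ] E} {a : F}
    (hφ : HasFDerivAt φ L a) (hφM : ∀ᶠ y in 𝓝 a, φ y ∈ M) (w : F) {η : ℝ} (hη : 0 < η) :
    ∀ᶠ t : ℝ in 𝓝[>] 0, infDist (φ a + t • L w) M ≤ η * t := by
  have hc : Tendsto (fun t : ℝ => a + t • w) (𝓝 0) (𝓝 a) := by
    have : Continuous fun t : ℝ => a + t • w := by fun_prop
    simpa using this.tendsto 0
  have hw : 0 < η / (‖w‖ + 1) := by positivity
  have h1 := (hc.eventually (hφ.isLittleO.bound hw)).and (hc.eventually hφM)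
  filter_upwards [nhdsWithin_le_nhds h1, self_mem_nhdsWithin] with t ht ht0
  have ht0' : 0 < t := ht0
  refine (infDist_le_dist_of_mem ht.2).trans ?_
  have h2 := ht.1
  rw [add_sub_cancel_left, map_smul, norm_smul, Real.norm_of_nonneg ht0'.le] at h2
  rw [dist_comm, dist_eq_norm, ← sub_sub]
  have h3 : η / (‖w‖ + 1) * (t * ‖w‖) ≤ η * t := by
    rw [div_mul_eq_mul_div, div_le_iff₀ (by positivity)]
    nlinarith [norm_nonneg w, mul_pos hη ht0']
  exact h2.trans h3

end TangentVectors

section TangentChart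

open Filter Topology
open scoped RealInnerProductSpace

variable {E : Type*} [NormedAddCommGroup E] [InnerProductSpace ℝ E] {M : Set E} {τ : ℝ}
variable {F : Type*} [NormedAddCommGroup F] [NormedSpace ℝ F]

/-- Around `q`, the set `M` contains an immersed piece parametrized by `F`, and every vector
normal to that piece at `q` is normal to `M` in the sense of the reach. -/
def HasTangentChart (F : Type*) [NormedAddCommGroup F] [NormedSpace ℝ F] (M : Set E) (τ : ℝ)
    (q : E) : Prop :=
  ∃ (φ : F → E) (L : F →L[ℝ] E), HasStrictFDerivAt φ L 0 ∧ φ 0 = q ∧ (∀ᶠ y in 𝓝 0, φ y ∈ M) ∧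
    Function.Injective L ∧ ∀ n, (∀ w, ⟪L w, n⟫ = 0) → n ∈ reachNormals M τ q

theorem HasTangentChart.neg_mem {q n : E} (hq : HasTangentChart F M τ q)
    (hn : n ∈ reachNormals M τ q) : -n ∈ reachNormals M τ q := by
  obtain ⟨φ, L, hφ, rfl, hφM, -, hN⟩ := hq
  refine hN _ fun w => ?_
  rw [inner_neg_right, inner_eq_zero_of_mem_reachNormals hφ.hasFDerivAt hφM hn, neg_zero]

/-- Near a point of a set of positive reach without boundary, the orthogonal projection to the
tangent space covers a ball whose radius is comparable to the reach. -/
theorem HasUniqueProj.exists_ball_subset_image [FiniteDimensional ℝ E] [FiniteDimensional ℝ F]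
    (h : HasUniqueProj M τ) (hτ : 0 < τ) (hM : IsCompact M)
    (hT : ∀ q ∈ M, HasTangentChart F M τ q) {x : E} (hx : x ∈ M) :
    ∃ W : Submodule ℝ E, Module.finrank ℝ W = Module.finrank ℝ F ∧
      ball (W.orthogonalProjectionOnto x) (τ / 200) ⊆ W.orthogonalProjectionOnto '' M := by
  have hsymm : ∀ z ∈ M, ∀ n ∈ reachNormals M τ z, -n ∈ reachNormals M τ z :=
    fun z hz n hn => (hT z hz).neg_mem hn
  obtain ⟨φ, L, -, -, -, hL, hN⟩ := hT x hx
  have hrank : Module.finrank ℝ L.range = Module.finrank ℝ F :=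
    LinearMap.finrank_range_of_inj hL
  refine ⟨L.range, hrank, ?_⟩
  set W := L.range
  set P := W.orthogonalProjectionOnto
  have hWN : ∀ n ∈ Wᗮ, n ∈ reachNormals M τ x := fun n hn => hN n fun w =>
    (Submodule.mem_orthogonal _ _).1 hn _ ⟨w, rfl⟩
  have hopen : ∀ q ∈ M, dist q x < τ / 100 → P '' (M ∩ closedBall x (τ / 100)) ∈ 𝓝 (P q) := by
    intro q hq hqx
    obtain ⟨ψ, L', hψ, rfl, hψM, hL', -⟩ := hT q hq
    have hcomp : HasStrictFDerivAt (fun y => P (ψ y)) (P.comp L') 0 :=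
      P.hasStrictFDerivAt.comp (0 : F) hψ
    have hinj : Function.Injective (P.comp L').toLinearMap := by
      rw [← LinearMap.ker_eq_bot, LinearMap.ker_eq_bot']
      intro w hw
      have hPw : P (L' w) = 0 := hw
      by_contra hw0
      have hLw : L' w ≠ 0 := fun h0 => hw0 (hL' (by rw [h0, map_zero]))
      have hpos : 0 < ‖L' w‖⁻¹ := inv_pos.2 (norm_pos_iff.2 hLw)
      refine h.notMem_reachNormals_of_tangent hτ hM hsymm hq (v := ‖L' w‖⁻¹ • L' w)
        (norm_smul_inv_norm (𝕜 := ℝ) hLw) (fun η hη => ?_) hqx.le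
        ((smul_mem_reachNormals_iff hpos).2 (hWN _ (W.orthogonalProjectionOnto_eq_zero_iff.1 hPw)))
      rw [← map_smul]
      exact hψ.hasFDerivAt.eventually_infDist_tangent_le hψM _ hη
    have hsurj : (P.comp L').range = ⊤ := by
      refine LinearMap.range_eq_top.2 ?_
      exact (LinearMap.injective_iff_surjective_of_finrank_eq_finrank hrank.symm).1 hinj
    rw [← hcomp.map_nhds_eq_of_surj hsurj, mem_map]
    filter_upwards [hψM, hψ.continuousAt.eventually (isOpen_ball.mem_nhds hqx)] with y hy hyx
    exact ⟨ψ y, ⟨hy, ball_subset_closedBall hyx⟩, rfl⟩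
  set K := P '' (M ∩ closedBall x (τ / 100))
  have hK : IsClosed K := ((hM.inter_right isClosed_closedBall).image P.continuous).isClosed
  have hsub : ball (P x) (τ / 200) ⊆ interior K := by
    refine (convex_ball _ _).isPreconnected.subset_of_closure_inter_subset isOpen_interior
      ⟨P x, mem_ball_self (by positivity), mem_interior_iff_mem_nhds.2
        (hopen x hx (by rw [dist_self]; positivity))⟩ ?_
    rintro y ⟨hy, hyx⟩
    obtain ⟨q, ⟨hq, hqx⟩, rfl⟩ := closure_minimal interior_subset hK hy
    refine mem_interior_iff_mem_nhds.2 (hopen q hq ?_)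
    have h1 : (q - x) - W.starProjection (q - x) ∈ Wᗮ := W.sub_starProjection_mem_orthogonal _
    set n := (q - x) - W.starProjection (q - x) with hn
    have h2 := hWN n h1 q hq
    have h3 : ⟪q - x, n⟫ = ‖n‖ ^ 2 := by
      have e : q - x = n + W.starProjection (q - x) := by rw [hn]; abel
      rw [e, inner_add_left, real_inner_self_eq_norm_sq,
        (Submodule.mem_orthogonal _ _).1 h1 _ (W.starProjection_apply_mem _), add_zero]
    have h4 : ‖W.starProjection (q - x)‖ < τ / 200 := by
      have h5 : ‖P (q - x)‖ < τ / 200 := by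
        rw [map_sub, ← dist_eq_norm]; exact hyx
      exact h5
    rw [mem_closedBall, dist_eq_norm] at hqx
    have h6 : ‖q - x‖ ≤ ‖n‖ + ‖W.starProjection (q - x)‖ := by
      calc ‖q - x‖ = ‖n + W.starProjection (q - x)‖ := by rw [hn]; congr 1; abel
        _ ≤ _ := norm_add_le _ _
    rw [h3, le_div_iff₀ (by positivity)] at h2
    have h7 : ‖q - x‖ ^ 2 ≤ (τ / 100) ^ 2 := by gcongr
    have h8 : ‖n‖ ≤ τ / 200 := by
      by_contra! hcon
      have h9 : ‖n‖ * ‖q - x‖ ^ 2 ≤ ‖n‖ * (τ / 100) ^ 2 := by gcongr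
      have h10 : 0 < ‖n‖ := lt_trans (by positivity) hcon
      have h11 : ‖n‖ * (‖n‖ * (2 * τ)) ≤ ‖n‖ * (τ / 100) ^ 2 := by nlinarith
      have h12 := le_of_mul_le_mul_left h11 h10
      nlinarith [mul_pos hτ hτ]
    rw [dist_eq_norm]
    linarith
  exact hsub.trans (interior_subset.trans (image_mono inter_subset_left))

/-- Volume bound for coverings of a ball by finitely many balls. -/
theorem pow_finrank_le_of_ball_subset_biUnion {W : Type*} [NormedAddCommGroup W]
    [NormedSpace ℝ W] [FiniteDimensional ℝ W] {ι : Type*} (s : Finset ι) (c : ι → W) (x : W)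
    {r ε : ℝ} (hr : 0 < r) (hε : 0 ≤ ε) (hs : ball x r ⊆ ⋃ i ∈ s, closedBall (c i) ε) :
    r ^ Module.finrank ℝ W ≤ s.card * ε ^ Module.finrank ℝ W := by
  borelize W
  let μ : MeasureTheory.Measure W := MeasureTheory.Measure.addHaar
  have h1 : μ (ball x r) ≤ ∑ i ∈ s, μ (closedBall (c i) ε) :=
    (MeasureTheory.measure_mono hs).trans (MeasureTheory.measure_biUnion_finset_le _ _)
  simp only [MeasureTheory.Measure.addHaar_ball_of_pos μ _ hr,
    MeasureTheory.Measure.addHaar_closedBall μ _ hε, Finset.sum_const, nsmul_eq_mul,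
    ← mul_assoc] at h1
  rw [ENNReal.mul_le_mul_iff_left (measure_ball_pos _ _ one_pos).ne'
      MeasureTheory.measure_ball_lt_top.ne,
    ← ENNReal.ofReal_natCast, ← ENNReal.ofReal_mul (by positivity),
    ENNReal.ofReal_le_ofReal_iff (by positivity)] at h1
  exact h1

theorem hasUniqueProj_reach {D : ℕ} {M : Set (EuclideanSpace ℝ (Fin D))} (h : 0 < reach M) :
    HasUniqueProj M (reach M) := by
  intro x hx
  have hne : {r : ℝ | ∀ x : EuclideanSpace ℝ (Fin D),
      Metric.infDist x M < r → uniqueProj M x}.Nonempty := by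
    by_contra hcon
    rw [reach, not_nonempty_iff_eq_empty.1 hcon, Real.sSup_empty] at h
    exact h.false
  obtain ⟨r, hr, hxr⟩ := exists_lt_of_lt_csSup hne hx
  exact hr x hxr

theorem IsC2Submanifold.hasTangentChart {D d : ℕ} {M : Set (EuclideanSpace ℝ (Fin D))}
    (hC : IsC2Submanifold d M) (hM : IsCompact M) {τ : ℝ} (hτ : 0 < τ) (h : HasUniqueProj M τ)
    {q : EuclideanSpace ℝ (Fin D)} (hq : q ∈ M) :
    HasTangentChart (EuclideanSpace ℝ (Fin d)) M τ q := by
  obtain ⟨φ, u, V, hu, h0, hφ0, hV, hqV, hφ, hinj, himg, hder⟩ := hC q hq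
  have hat : ∀ a ∈ u, ContDiffAt ℝ 2 φ a := fun a ha => hφ.contDiffAt (hu.mem_nhds ha)
  have hφM : ∀ a ∈ u, φ a ∈ M := fun a ha =>
    (himg ▸ mem_image_of_mem φ ha : φ a ∈ M ∩ V).1
  have hev : ∀ᶠ y in 𝓝 (0 : EuclideanSpace ℝ (Fin d)), φ y ∈ M :=
    (hu.eventually_mem h0).mono hφM
  have hs := (hat 0 h0).hasStrictFDerivAt (by norm_num)
  have hrank : ∀ a ∈ u, Module.finrank ℝ (fderiv ℝ φ a).rangeᗮ = D - d := fun a ha => by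
    have h1 := (fderiv ℝ φ a).range.finrank_add_finrank_orthogonal
    have h2 : Module.finrank ℝ (fderiv ℝ φ a).range = _ :=
      LinearMap.finrank_range_of_inj (hder a ha)
    rw [h2, finrank_euclideanSpace_fin, finrank_euclideanSpace_fin] at h1
    omega
  have hmem : ∀ a n, n ∈ (fderiv ℝ φ a).rangeᗮ ↔ ∀ w, ⟪fderiv ℝ φ a w, n⟫ = 0 := fun a n => by
    rw [Submodule.mem_orthogonal]
    exact ⟨fun H w => H _ ⟨w, rfl⟩, fun H => by rintro _ ⟨w, rfl⟩; exact H w⟩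
  have hfill : ((fderiv ℝ φ 0).rangeᗮ : Set (EuclideanSpace ℝ (Fin D))) ⊆ reachNormals M τ q := by
    refine subset_reachNormals_of_approx (hrank 0 h0) (fun n hn => ?_) fun ρ hρ => ?_
    · exact (hmem 0 n).2 fun w =>
        inner_eq_zero_of_mem_reachNormals hs.hasFDerivAt hev (by rwa [hφ0]) w
    · obtain ⟨a, ha, haq, hloc⟩ :=
        exists_nhdsWithin_le_map_nhds hM hu hV hφ.continuousOn hinj himg ⟨hq, hqV⟩ hρ
      let b := (stdOrthonormalBasis ℝ (fderiv ℝ φ a).rangeᗮ).reindex (finCongr (hrank a ha))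
      refine ⟨φ a, haq, fun i => b i,
        b.orthonormal.comp_linearIsometry (fderiv ℝ φ a).rangeᗮ.subtypeₗᵢ, fun c => ?_⟩
      refine h.mem_reachNormals_of_chart hτ hM (hat a ha) (hder a ha) (hφM a ha) hloc
        ((hmem a _).1 ?_)
      exact Submodule.sum_mem _ fun i _ => Submodule.smul_mem _ _ (b i).2
  exact ⟨φ, fderiv ℝ φ 0, hs, hφ0, hev, hder 0 h0, fun n hn => hfill ((hmem 0 n).2 hn)⟩

end TangentChart

/-- There is a constant `c_d > 0`, depending only on `d`, such that for every compact `C²`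
`d`-dimensional submanifold `M ⊆ ℝ^D` with positive reach and every finite `A ⊆ M` of
cardinality `n`, `ε(A) ≥ c_d τ(M) n^{-1/d}`. -/
theorem epsRate_lower_bound (d : ℕ) (hd : 0 < d) :
    ∃ c : ℝ, 0 < c ∧ ∀ (D : ℕ) (M A : Set (EuclideanSpace ℝ (Fin D))),
      IsCompact M → IsC2Submanifold d M → 0 < reach M → A ⊆ M → A.Finite →
      epsRate M A ≥ c * reach M * (A.ncard : ℝ) ^ (-(1 : ℝ) / d) := by
  refine ⟨1 / 200, by norm_num, fun D M A hM hC hτ hAM hA => ?_⟩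
  have hd' : (d : ℝ) ≠ 0 := by positivity
  have hε : 0 ≤ epsRate M A := Real.sSup_nonneg (by rintro _ ⟨x, -, rfl⟩; exact infDist_nonneg)
  rcases A.eq_empty_or_nonempty with rfl | hne
  · rw [ncard_empty, Nat.cast_zero, Real.zero_rpow (by simp [hd.ne']), mul_zero]
    exact hε
  have hu := hasUniqueProj_reach hτ
  obtain ⟨x, hx⟩ := hne.mono hAM
  obtain ⟨W, hW, hball⟩ := hu.exists_ball_subset_image hτ hM
    (fun q hq => hC.hasTangentChart hM hτ hu hq) hx
  rw [finrank_euclideanSpace_fin] at hW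
  have hcov : ∀ p ∈ M, ∃ a ∈ A, dist p a ≤ epsRate M A := by
    intro p hp
    obtain ⟨a, ha, hpa⟩ := hA.isCompact.exists_infDist_eq_dist hne p
    refine ⟨a, ha, hpa ▸ le_csSup ?_ (mem_image_of_mem _ hp)⟩
    exact (hM.image (continuous_infDist_pt A)).bddAbove
  have hvol := pow_finrank_le_of_ball_subset_biUnion hA.toFinset W.orthogonalProjectionOnto
    (W.orthogonalProjectionOnto x) (r := reach M / 200) (by positivity) hε (by
      intro y hy
      obtain ⟨p, hp, rfl⟩ := hball hy
      obtain ⟨a, ha, hpa⟩ := hcov p hp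
      refine mem_biUnion (x := a) (by simpa using ha) ?_
      exact (W.lipschitzWith_orthogonalProjectionOnto.dist_le_mul p a).trans (by simpa using hpa))
  rw [hW, ← ncard_eq_toFinset_card A hA] at hvol
  have hn : 0 < (A.ncard : ℝ) := by exact_mod_cast (ncard_pos hA).2 hne
  refine (pow_le_pow_iff_left₀ (by positivity) hε hd.ne').1 ?_
  rw [mul_pow, ← Real.rpow_mul_natCast hn.le, div_mul_cancel₀ _ hd', Real.rpow_neg_one,
    ← div_eq_mul_inv, div_le_iff₀ hn]
  calc (1 / 200 * reach M) ^ d = (reach M / 200) ^ d := by ring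
    _ ≤ _ := hvol
    _ = _ := mul_comm _ _
end
end

section
/- Let M be a compact C² submanifold of ℝ^D with reach τ(M) > 0 and let y₁, y₂ ∈ ℝ^D be two points each at distance at most γ < τ(M) from M. Then |π_M(y₁) − π_M(y₂)| ≤ (τ(M)/(τ(M) − γ)) · |y₁ − y₂|, where π_M denotes the metric projection onto M. -/
open Metric Set

noncomputable section

variable {D d : ℕ}

section NearestPoint

variable {E : Type*} [NormedAddCommGroup E] [InnerProductSpace ℝ E]

/-- If `a` is the only nearest point of `M` to `q`, then moving `q` slightly in a direction `w` with
`⟪w, q - a⟫ > 0` can increase the distance to `M`. -/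
lemma exists_infDist_lt_infDist_add_smul {M : Set E} (hM : IsCompact M) (hne : M.Nonempty)
    {q a w : E} (huniq : ∀ b ∈ M, dist q b = infDist q M → b = a)
    (hw : 0 < inner ℝ w (q - a)) {r : ℝ} (hr : 0 < r) :
    ∃ ε, 0 < ε ∧ ε < r ∧ infDist q M < infDist (q + ε • w) M := by
  by_contra! H
  set e : ℕ → ℝ := fun k => r / 2 * (1 / ((k : ℝ) + 1)) with he
  have he0 : ∀ k, 0 < e k := fun k => by positivity
  have her : ∀ k, e k < r := fun k => by
    have : 1 / ((k : ℝ) + 1) ≤ 1 := by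
      rw [div_le_one (by positivity)]
      linarith [(Nat.cast_nonneg k : (0 : ℝ) ≤ k)]
    simp only [he]
    nlinarith
  have hlim : Filter.Tendsto e Filter.atTop (nhds 0) := by
    simpa [he] using (tendsto_one_div_add_atTop_nhds_zero_nat (𝕜 := ℝ)).const_mul (r / 2)
  choose b hbM hb using fun k => hM.exists_infDist_eq_dist hne (q + e k • w)
  obtain ⟨c, hcM, f, hf, hfc⟩ := hM.tendsto_subseq hbM
  have hx : Filter.Tendsto (fun k => q + e (f k) • w) Filter.atTop (nhds q) := by
    simpa using ((hlim.comp hf.tendsto_atTop).smul_const w).const_add q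
  have hdist : dist q c = infDist q M := by
    refine tendsto_nhds_unique (hx.dist hfc) ?_
    have := (continuous_infDist_pt M).continuousAt.tendsto.comp hx
    exact this.congr fun k => hb (f k)
  have hle : ∀ k, inner ℝ w (q - b k) ≤ 0 := by
    intro k
    have h1 : ‖q + e k • w - b k‖ ≤ ‖q - b k‖ := by
      rw [← dist_eq_norm, ← dist_eq_norm, ← hb k]
      exact (H _ (he0 k) (her k)).trans (infDist_le_dist_of_mem (hbM k))
    have h2 : ‖q + e k • w - b k‖ ^ 2
        = ‖q - b k‖ ^ 2 + 2 * (e k * inner ℝ w (q - b k)) + ‖e k • w‖ ^ 2 := by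
      rw [show q + e k • w - b k = (q - b k) + e k • w by abel, norm_add_sq_real,
        inner_smul_right, real_inner_comm]
    have h3 : ‖q + e k • w - b k‖ ^ 2 ≤ ‖q - b k‖ ^ 2 := by gcongr
    have h4 : e k * inner ℝ w (q - b k) ≤ 0 := by nlinarith [sq_nonneg ‖e k • w‖]
    by_contra! h5
    exact absurd h4 (not_le.2 (mul_pos (he0 k) h5))
  have hcle : inner ℝ w (q - c) ≤ 0 := by
    have ht : Filter.Tendsto (fun k => inner ℝ w (q - b (f k))) Filter.atTop
        (nhds (inner ℝ w (q - c))) := tendsto_const_nhds.inner (hfc.const_sub q)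
    exact le_of_tendsto' ht fun k => hle (f k)
  rw [huniq c hcM hdist] at hcle
  exact absurd hcle (not_le.2 hw)

/-- If nearest points are unique within distance `τ` of `M`, a normal segment from `a` to `p` can be
extended beyond `p` with `a` remaining a nearest point. -/
lemma infDist_add_smul_eq_of_uniqueness [ProperSpace E] {M : Set E} (hM : IsCompact M)
    (hne : M.Nonempty) {τ : ℝ}
    (huniq : ∀ x, infDist x M < τ → ∃! y, y ∈ M ∧ dist x y = infDist x M)
    {a v : E} (haM : a ∈ M) (hv : ‖v‖ = 1) {t s : ℝ} (hs : 0 < s) (hst : s < t)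
    (hts : t + s < τ) (ht : infDist (a + t • v) M = t) :
    infDist (a + (t + s) • v) M = t + s := by
  set p := a + t • v with hp
  have hpa : dist p a = t := by
    rw [dist_eq_norm, hp, add_sub_cancel_left, norm_smul, hv, mul_one, Real.norm_eq_abs,
      abs_of_pos (by linarith)]
  obtain ⟨q, hq, hqmax⟩ := (isCompact_closedBall p s).exists_isMaxOn
    ⟨p, mem_closedBall_self hs.le⟩ (continuous_infDist_pt M).continuousOn
  have hqmax' : ∀ x, dist x p ≤ s → infDist x M ≤ infDist q M := fun x hx => hqmax hx
  have hqp : dist q p ≤ s := hq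
  have hqt : t ≤ infDist q M := by
    simpa [ht] using hqmax' p (by simpa using hs.le)
  have hqle : infDist q M ≤ infDist p M + dist q p := infDist_le_infDist_add_dist
  obtain ⟨b, ⟨hbM, hb⟩, hbu⟩ := huniq q (by linarith)
  have hlocal : ∀ w : E, 0 < inner ℝ w (q - b) → ∀ r : ℝ, 0 < r →
      ∃ ε, 0 < ε ∧ ε < r ∧ s < dist (q + ε • w) p := by
    intro w hw r hr
    obtain ⟨ε, h0, h1, h2⟩ := exists_infDist_lt_infDist_add_smul hM hne
      (fun c hc hcd => hbu c ⟨hc, hcd⟩) hw hr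
    exact ⟨ε, h0, h1, not_le.1 fun h => absurd (hqmax' _ h) (not_le.2 h2)⟩
  set n := q - b with hn
  set u := q - p with hu
  have hnn : ‖n‖ = infDist q M := by rw [← hb, dist_eq_norm]
  have hnpos : 0 < ‖n‖ := by linarith
  have hus : ‖u‖ = s := by
    refine le_antisymm (by rwa [hu, ← dist_eq_norm]) ?_
    by_contra! hlt
    obtain ⟨ε, h0, h1, h2⟩ := hlocal n (by rw [real_inner_self_eq_norm_sq]; positivity)
      ((s - ‖u‖) / ‖n‖) (div_pos (by linarith) hnpos)
    rw [lt_div_iff₀ hnpos] at h1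
    rw [dist_eq_norm, show q + ε • n - p = u + ε • n by rw [hu]; abel] at h2
    have h3 := norm_add_le u (ε • n)
    rw [norm_smul, Real.norm_eq_abs, abs_of_pos h0] at h3
    linarith
  have hpar : inner ℝ n u = ‖n‖ * ‖u‖ := by
    refine le_antisymm (real_inner_le_norm n u) ?_
    by_contra! hlt
    set w := ‖u‖ • n - ‖n‖ • u with hw
    have hwn : 0 < inner ℝ w n := by
      rw [hw, inner_sub_left, real_inner_smul_left, real_inner_smul_left,
        real_inner_self_eq_norm_sq, real_inner_comm]
      nlinarith
    have hwu : inner ℝ u w < 0 := by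
      rw [hw, inner_sub_right, real_inner_smul_right, real_inner_smul_right,
        real_inner_self_eq_norm_sq, real_inner_comm]
      have : 0 < ‖u‖ := by linarith
      nlinarith
    obtain ⟨ε, h0, h1, h2⟩ := hlocal w hwn (-(2 * inner ℝ u w) / (‖w‖ ^ 2 + 1))
      (div_pos (by linarith) (by positivity))
    rw [lt_div_iff₀ (by positivity)] at h1
    rw [dist_eq_norm, show q + ε • w - p = u + ε • w by rw [hu]; abel] at h2
    have h3 := norm_add_sq_real u (ε • w)
    rw [norm_smul, Real.norm_eq_abs, abs_of_pos h0, real_inner_smul_right, hus] at h3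
    have h4 : s ^ 2 < ‖u + ε • w‖ ^ 2 := by gcongr
    have h5 : 0 < ε * (2 * inner ℝ u w + ε * ‖w‖ ^ 2) := by nlinarith
    have h6 := pos_of_mul_pos_right h5 h0.le
    nlinarith
  have hsn : ‖u‖ • n = ‖n‖ • u := inner_eq_norm_mul_iff_real.1 hpar
  rw [hus] at hsn
  have hpb : p - b = (1 - s / ‖n‖) • n := by
    have h1 : u = (s / ‖n‖) • n := by
      rw [div_eq_inv_mul, mul_smul, hsn, smul_smul, inv_mul_cancel₀ hnpos.ne', one_smul]
    rw [sub_smul, one_smul, ← h1, hn, hu]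
    abel
  have hdpb : dist p b = ‖n‖ - s := by
    have h1 : 0 ≤ 1 - s / ‖n‖ := by
      rw [sub_nonneg, div_le_one hnpos]
      linarith
    rw [dist_eq_norm, hpb, norm_smul, Real.norm_eq_abs, abs_of_nonneg h1]
    field_simp
  have hpbM : dist p b = infDist p M :=
    le_antisymm (by linarith) (infDist_le_dist_of_mem hbM)
  have hba : b = a :=
    (huniq p (by linarith)).unique ⟨hbM, hpbM⟩ ⟨haM, by rw [hpa, ht]⟩
  have hnts : ‖n‖ = t + s := by linarith
  have hqeq : q = a + (t + s) • v := by
    have h1 : t • v = (1 - s / (t + s)) • n := by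
      rw [← hnts, ← hpb, hba, hp, add_sub_cancel_left]
    have h2 : n = (t + s) • v := by
      have h3 : (1 - s / (t + s)) = t / (t + s) := by
        have : t + s ≠ 0 := by linarith
        field_simp
        ring
      have h4 : v = (1 / (t + s)) • n := by
        have := congrArg (fun z => (1 / t) • z) h1
        simp only [smul_smul, h3] at this
        rw [one_div_mul_cancel (by linarith), one_smul] at this
        rw [this]
        congr 1
        have : t ≠ 0 := by linarith
        field_simp
      rw [h4, smul_smul, mul_one_div_cancel (by linarith), one_smul]
    rw [← h2, hn, hba]
    abel
  rw [← hqeq, ← hnn, hnts]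

/-- Along a unit normal direction `v` at `a`, the point `a` stays nearest up to distance `τ`. -/
lemma infDist_add_smul_eq_of_lt [ProperSpace E] {M : Set E} (hM : IsCompact M)
    (hne : M.Nonempty) {τ : ℝ}
    (huniq : ∀ x, infDist x M < τ → ∃! y, y ∈ M ∧ dist x y = infDist x M)
    {a v : E} (haM : a ∈ M) (hv : ‖v‖ = 1) {t₀ t : ℝ} (ht₀ : 0 < t₀)
    (h₀ : infDist (a + t₀ • v) M = t₀) (hle : t₀ ≤ t) (htτ : t < τ) :
    infDist (a + t • v) M = t := by
  have hcl : IsClosed ({x : ℝ | infDist (a + x • v) M = x} ∩ Icc t₀ t) := by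
    refine (isClosed_eq ?_ continuous_id).inter isClosed_Icc
    exact (continuous_infDist_pt M).comp (by fun_prop)
  refine hcl.Icc_subset_of_forall_exists_gt h₀ ?_ (right_mem_Icc.2 hle)
  rintro x ⟨hx, hx₀, hxt⟩ y hy
  have hy : x < y := hy
  set s := min (min x (y - x)) (τ - x) / 2 with hs
  have hm : 0 < min (min x (y - x)) (τ - x) :=
    lt_min (lt_min (by linarith) (by linarith)) (by linarith)
  have h1 : min (min x (y - x)) (τ - x) ≤ x := (min_le_left _ _).trans (min_le_left _ _)
  have h2 : min (min x (y - x)) (τ - x) ≤ y - x := (min_le_left _ _).trans (min_le_right _ _)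
  have h3 : min (min x (y - x)) (τ - x) ≤ τ - x := min_le_right _ _
  exact ⟨x + s, infDist_add_smul_eq_of_uniqueness hM hne huniq haM hv (by linarith)
    (by linarith) (by linarith) hx, by linarith, by linarith⟩

/-- Federer's estimate for the inner product of a normal vector with a chord. -/
lemma inner_sub_sub_le_of_uniqueness [ProperSpace E] {M : Set E} (hM : IsCompact M) {τ : ℝ}
    (huniq : ∀ x, infDist x M < τ → ∃! y, y ∈ M ∧ dist x y = infDist x M)
    {x a b : E} (haM : a ∈ M) (hbM : b ∈ M) (hx : infDist x M < τ)
    (ha : dist x a = infDist x M) :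
    2 * τ * inner ℝ (x - a) (b - a) ≤ infDist x M * ‖b - a‖ ^ 2 := by
  rcases (infDist_nonneg (x := x) (s := M)).eq_or_lt with h0 | hpos
  · rw [← h0, dist_eq_zero] at ha
    simp [ha, infDist_zero_of_mem haM]
  set δ := infDist x M with hδ
  have hnorm : ‖x - a‖ = δ := by rw [← dist_eq_norm, ha]
  obtain ⟨v, hv⟩ : ∃ v, v = δ⁻¹ • (x - a) := ⟨_, rfl⟩
  have hxv : x - a = δ • v := by rw [hv, smul_smul, mul_inv_cancel₀ hpos.ne', one_smul]
  have hv1 : ‖v‖ = 1 := by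
    rw [hv, norm_smul, hnorm, Real.norm_eq_abs, abs_of_pos (inv_pos.2 hpos),
      inv_mul_cancel₀ hpos.ne']
  have hbound : ∀ t ∈ Ioo δ τ, 2 * t * inner ℝ v (b - a) ≤ ‖b - a‖ ^ 2 := by
    intro t ht
    have h1 : infDist (a + t • v) M = t :=
      infDist_add_smul_eq_of_lt hM ⟨a, haM⟩ huniq haM hv1 hpos
        (by rw [← hxv, add_sub_cancel]) ht.1.le ht.2
    have h2 : t ≤ ‖t • v - (b - a)‖ := by
      have := infDist_le_dist_of_mem (x := a + t • v) hbM
      rwa [h1, dist_eq_norm, show a + t • v - b = t • v - (b - a) by abel] at this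
    have ht0 : 0 < t := hpos.trans ht.1
    have h3 : t ^ 2 ≤ ‖t • v - (b - a)‖ ^ 2 := by gcongr
    rw [norm_sub_sq_real, real_inner_smul_left, norm_smul, hv1, mul_one, Real.norm_eq_abs,
      sq_abs] at h3
    linarith
  have hτ : 2 * τ * inner ℝ v (b - a) ≤ ‖b - a‖ ^ 2 := by
    have hc : IsClosed {t : ℝ | 2 * t * inner ℝ v (b - a) ≤ ‖b - a‖ ^ 2} :=
      isClosed_le (by fun_prop) continuous_const
    have := closure_minimal hbound hc
    rw [closure_Ioo hx.ne] at this
    exact this (right_mem_Icc.2 hx.le)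
  rw [hxv, real_inner_smul_left]
  nlinarith

end NearestPoint

lemma uniqueProj_of_infDist_lt_reach {M : Set (EuclideanSpace ℝ (Fin D))} (hτ : 0 < reach M)
    {x : EuclideanSpace ℝ (Fin D)} (hx : infDist x M < reach M) : uniqueProj M x := by
  have hne : {r : ℝ | ∀ x : EuclideanSpace ℝ (Fin D),
      infDist x M < r → uniqueProj M x}.Nonempty := by
    by_contra! h
    simp [reach, h] at hτ
  obtain ⟨r, hr, hxr⟩ := exists_lt_of_lt_csSup hne hx
  exact hr x hxr

lemma projOn_mem_and_dist_eq {M : Set (EuclideanSpace ℝ (Fin D))} {x : EuclideanSpace ℝ (Fin D)}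
    (hx : uniqueProj M x) : projOn M x ∈ M ∧ dist x (projOn M x) = infDist x M := by
  unfold projOn
  rw [dif_pos hx.exists]
  exact hx.exists.choose_spec

/-- The metric projection onto `M` is `τ(M)/(τ(M) − γ)`-Lipschitz on the `γ`-neighborhood. -/
theorem projOn_lipschitz {D d : ℕ} (M : Set (EuclideanSpace ℝ (Fin D)))
    (hMc : IsCompact M) (hM : IsC2Submanifold d M) (hτ : 0 < reach M)
    (γ : ℝ) (hγ : γ < reach M) (y₁ y₂ : EuclideanSpace ℝ (Fin D))
    (h₁ : Metric.infDist y₁ M ≤ γ) (h₂ : Metric.infDist y₂ M ≤ γ) :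
    dist (projOn M y₁) (projOn M y₂) ≤ reach M / (reach M - γ) * dist y₁ y₂ := by
  have huniq := fun x => uniqueProj_of_infDist_lt_reach (M := M) hτ (x := x)
  obtain ⟨ha₁, hd₁⟩ := projOn_mem_and_dist_eq (huniq y₁ (h₁.trans_lt hγ))
  obtain ⟨ha₂, hd₂⟩ := projOn_mem_and_dist_eq (huniq y₂ (h₂.trans_lt hγ))
  set a₁ := projOn M y₁
  set a₂ := projOn M y₂
  have e₁ := inner_sub_sub_le_of_uniqueness hMc huniq ha₁ ha₂ (h₁.trans_lt hγ) hd₁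
  have e₂ := inner_sub_sub_le_of_uniqueness hMc huniq ha₂ ha₁ (h₂.trans_lt hγ) hd₂
  have hneg : inner ℝ (y₂ - a₂) (a₁ - a₂) = -inner ℝ (y₂ - a₂) (a₂ - a₁) := by
    rw [← inner_neg_right, neg_sub]
  rw [norm_sub_rev a₁ a₂, hneg] at e₂
  have hsum : inner ℝ (y₁ - a₁) (a₂ - a₁) - inner ℝ (y₂ - a₂) (a₂ - a₁)
      = ‖a₂ - a₁‖ ^ 2 - inner ℝ (y₂ - y₁) (a₂ - a₁) := by
    rw [← real_inner_self_eq_norm_sq, ← inner_sub_left, ← inner_sub_left]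
    congr 1
    abel
  have hcs := real_inner_le_norm (y₂ - y₁) (a₂ - a₁)
  rw [dist_comm, dist_comm y₁, dist_eq_norm, dist_eq_norm, div_mul_eq_mul_div,
    le_div_iff₀ (by linarith)]
  rcases (norm_nonneg (a₂ - a₁)).eq_or_lt with h0 | hpos
  · rw [← h0, zero_mul]
    positivity
  have f₁ : infDist y₁ M * ‖a₂ - a₁‖ ^ 2 ≤ γ * ‖a₂ - a₁‖ ^ 2 := by gcongr
  have f₂ : infDist y₂ M * ‖a₂ - a₁‖ ^ 2 ≤ γ * ‖a₂ - a₁‖ ^ 2 := by gcongr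
  have hmul := mul_le_mul_of_nonneg_left hcs hτ.le
  have hsum' := congrArg (reach M * ·) hsum
  simp only [mul_sub] at hsum'
  refine le_of_mul_le_mul_right ?_ hpos
  nlinarith
end
end

section
/- Let X₁, …, X_n be i.i.d. points uniformly distributed on the unit circle in ℝ², sorted by angle as X_(1), …, X_(n) with consecutive chord half-lengths t_i := |X_(i+1) − X_(i)|/2 (indices cyclic). Order these as t_(1) ≤ ⋯ ≤ t_(n). Then for any t ∈ [t_(i), t_(i+1)), the convexity defect function of the sample 𝒳_n = {X₁,…,X_n} satisfies h(t, 𝒳_n) ≤ t_(i) + t_(i+1)², where h(t, A) := d_H(Conv(t, A), A). -/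
open Metric Set

noncomputable section

variable {D d : ℕ}

/-- The point of the unit circle at angle `α`. -/
def circlePoint (α : ℝ) : EuclideanSpace ℝ (Fin 2) := !₂[Real.cos α, Real.sin α]

lemma circlePoint_add_int_mul_two_pi (α : ℝ) (m : ℤ) :
    circlePoint (α + m * (2 * Real.pi)) = circlePoint α := by
  simp [circlePoint, Real.cos_add_int_mul_two_pi, Real.sin_add_int_mul_two_pi]

lemma dist_smul_circlePoint_sq (ρ α β : ℝ) :
    dist (ρ • circlePoint α) (circlePoint β) ^ 2
      = (ρ - Real.cos (α - β)) ^ 2 + Real.sin (α - β) ^ 2 := by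
  rw [EuclideanSpace.dist_sq_eq]
  simp only [circlePoint, Fin.sum_univ_two, Real.dist_eq, sq_abs, Real.cos_sub, Real.sin_sub,
    PiLp.smul_apply, smul_eq_mul, Matrix.cons_val_zero, Matrix.cons_val_one]
  linear_combination (ρ ^ 2 - (Real.cos β ^ 2 + Real.sin β ^ 2)) *
    Real.cos_sq_add_sin_sq α

lemma dist_circlePoint_sq (α β : ℝ) :
    dist (circlePoint α) (circlePoint β) ^ 2 = (2 * Real.sin ((α - β) / 2)) ^ 2 := by
  have h := dist_smul_circlePoint_sq 1 α β
  rw [one_smul] at h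
  have h1 : Real.cos (α - β) = 1 - 2 * Real.sin ((α - β) / 2) ^ 2 := by
    rw [← Real.cos_two_mul_eq_one_sub]; ring_nf
  have h2 := Real.sin_sq_add_cos_sq (α - β)
  rw [h]
  linear_combination h2 - 2 * h1

lemma dist_circlePoint {α β : ℝ} (h₀ : β ≤ α) (h₁ : α - β ≤ 2 * Real.pi) :
    dist (circlePoint α) (circlePoint β) = 2 * Real.sin ((α - β) / 2) := by
  have : 0 ≤ Real.sin ((α - β) / 2) := Real.sin_nonneg_of_nonneg_of_le_pi (by linarith)
    (by linarith)
  exact (pow_left_inj₀ dist_nonneg (by positivity) two_ne_zero).1 (dist_circlePoint_sq α β)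

/-- A vector in the open half plane with inner normal at angle `ω` has polar coordinates with
angle within `π / 2` of `ω`. -/
lemma exists_eq_smul_circlePoint (v : EuclideanSpace ℝ (Fin 2)) (ω : ℝ)
    (hv : 0 < inner ℝ (circlePoint ω) v) :
    ∃ ρ : ℝ, 0 < ρ ∧ ∃ β, |β| < Real.pi / 2 ∧ v = ρ • circlePoint (ω + β) := by
  set a := v 0 * Real.cos ω + v 1 * Real.sin ω with ha
  set b := v 1 * Real.cos ω - v 0 * Real.sin ω with hb
  have ha0 : 0 < a := by
    simpa [circlePoint, PiLp.inner_apply, Fin.sum_univ_two, ha] using hv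
  have hc : 0 < Real.cos (Real.arctan (b / a)) := Real.cos_arctan_pos _
  refine ⟨a / Real.cos (Real.arctan (b / a)), by positivity, Real.arctan (b / a),
    abs_lt.2 ⟨by simpa using Real.neg_pi_div_two_lt_arctan _, Real.arctan_lt_pi_div_two _⟩, ?_⟩
  have ht : Real.sin (Real.arctan (b / a)) = b / a * Real.cos (Real.arctan (b / a)) := by
    rw [← Real.tan_mul_cos hc.ne', Real.tan_arctan]
  have h := Real.cos_sq_add_sin_sq ω
  ext i
  fin_cases i
  · simp only [circlePoint, Real.cos_add, ht, PiLp.smul_apply, smul_eq_mul, Fin.zero_eta,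
      Matrix.cons_val_zero]
    field_simp
    rw [ha, hb]
    linear_combination -v 0 * h
  · simp only [circlePoint, Real.sin_add, ht, PiLp.smul_apply, smul_eq_mul, Fin.mk_one,
      Matrix.cons_val_one, Matrix.cons_val_zero]
    field_simp
    rw [ha, hb]
    linear_combination -v 1 * h

lemma inner_circlePoint_smul (ρ α β : ℝ) :
    inner ℝ (circlePoint α) (ρ • circlePoint β) = ρ * Real.cos (β - α) := by
  simp [circlePoint, PiLp.inner_apply, Fin.sum_univ_two, Real.cos_sub]
  ring

lemma norm_circlePoint (α : ℝ) : ‖circlePoint α‖ = 1 := by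
  simp [EuclideanSpace.norm_eq, circlePoint]

lemma convexHull_subset_halfSpace {s : Set (EuclideanSpace ℝ (Fin 2))}
    (v : EuclideanSpace ℝ (Fin 2)) {c : ℝ} (h : ∀ p ∈ s, c ≤ inner ℝ v p) :
    ∀ x ∈ convexHull ℝ s, c ≤ inner ℝ v x := fun _ hx =>
  convexHull_min h (convex_halfSpace_ge (innerₗ _ v).isLinear c) hx

/-- Points of the unit circle in a ball of radius `sin φ < 1` lie in a cap of half-angle `φ`. -/
lemma exists_cap {s : Set (EuclideanSpace ℝ (Fin 2))} (hs : ∀ p ∈ s, ‖p‖ = 1)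
    {z : EuclideanSpace ℝ (Fin 2)} {φ : ℝ} (hφ : 0 < Real.cos φ)
    (hz : s ⊆ closedBall z (Real.sin φ)) :
    ∃ ω, ∀ p ∈ s, Real.cos φ ≤ inner ℝ (circlePoint ω) p := by
  have key : ∀ p ∈ s, Real.cos φ ^ 2 + ‖z‖ ^ 2 ≤ 2 * inner ℝ z p := by
    intro p hp
    have h1 : ‖p - z‖ ≤ Real.sin φ := by simpa [dist_eq_norm] using hz hp
    have h2 := @norm_sub_sq_real _ _ _ p z
    have h3 := pow_le_pow_left₀ (norm_nonneg _) h1 2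
    have h4 := Real.sin_sq_add_cos_sq φ
    rw [hs p hp, real_inner_comm] at h2
    linarith
  rcases eq_or_ne z 0 with rfl | hz0
  · refine ⟨0, fun p hp => ?_⟩
    have := key p hp
    simp only [norm_zero, inner_zero_left] at this
    nlinarith
  · obtain ⟨ρ, hρ, ω, hω⟩ : ∃ ρ : ℝ, 0 < ρ ∧ ∃ ω, z = ρ • circlePoint ω := by
      have hc : (⟨z 0, z 1⟩ : ℂ) ≠ 0 := by
        intro h
        apply hz0
        ext i
        fin_cases i
        · exact congrArg Complex.re h
        · exact congrArg Complex.im h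
      refine ⟨‖(⟨z 0, z 1⟩ : ℂ)‖, norm_pos_iff.2 hc, Complex.arg ⟨z 0, z 1⟩, ?_⟩
      ext i
      fin_cases i
      · simp [circlePoint, Complex.norm_mul_cos_arg]
      · simp [circlePoint, Complex.norm_mul_sin_arg]
    refine ⟨ω, fun p hp => ?_⟩
    have := key p hp
    rw [hω, inner_smul_left, norm_smul, norm_circlePoint] at this
    simp only [conj_trivial, mul_one, Real.norm_eq_abs, sq_abs] at this
    nlinarith [sq_nonneg (Real.cos φ - ρ)]

/-- A point in the convex hull of a finite subset of a cap of half-angle `φ` lies in the angular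
sector spanned by two points of the subset. -/
lemma exists_sector {s : Set (EuclideanSpace ℝ (Fin 2))} (hfin : s.Finite)
    (hs : ∀ p ∈ s, ‖p‖ = 1) {φ ω : ℝ} (hφ₀ : 0 ≤ φ) (hφ : φ < Real.pi / 2)
    (hω : ∀ p ∈ s, Real.cos φ ≤ inner ℝ (circlePoint ω) p)
    {x : EuclideanSpace ℝ (Fin 2)} (hx : x ∈ convexHull ℝ s) :
    ∃ ρ lo α hi, x = ρ • circlePoint α ∧ Real.cos φ ≤ ρ ∧ ρ ≤ 1 ∧ lo ≤ α ∧ α ≤ hi ∧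
      hi - lo ≤ 2 * φ ∧ circlePoint lo ∈ s ∧ circlePoint hi ∈ s := by
  have hcos : 0 < Real.cos φ := Real.cos_pos_of_mem_Ioo ⟨by linarith, hφ⟩
  have lift : ∀ p ∈ s, ∃ β, |β| ≤ φ ∧ p = circlePoint (ω + β) := by
    intro p hp
    obtain ⟨ρ, hρ, β, hβ, rfl⟩ := exists_eq_smul_circlePoint p ω (hcos.trans_le (hω p hp))
    have h1 := hs _ hp
    rw [norm_smul, norm_circlePoint, mul_one, Real.norm_eq_abs, abs_of_pos hρ] at h1
    subst h1
    refine ⟨β, ?_, one_smul _ _⟩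
    have h2 := hω _ hp
    rw [inner_circlePoint_smul, one_mul, add_sub_cancel_left, ← Real.cos_abs β] at h2
    by_contra! h
    exact absurd (Real.cos_lt_cos_of_nonneg_of_le_pi hφ₀ (by linarith [Real.pi_pos]) h)
      (not_lt.2 h2)
  have hne : s.Nonempty := convexHull_nonempty_iff.1 ⟨x, hx⟩
  choose! ang hang hpt using lift
  obtain ⟨p, hp, hpmin⟩ := s.exists_min_image ang hfin hne
  obtain ⟨q, hq, hqmax⟩ := s.exists_max_image ang hfin hne
  have hxω := convexHull_subset_halfSpace _ hω x hx
  obtain ⟨ρ, hρ, γ, hγ, rfl⟩ := exists_eq_smul_circlePoint x ω (hcos.trans_le hxω)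
  rw [inner_circlePoint_smul, add_sub_cancel_left] at hxω
  have hball : ρ ≤ 1 := by
    have : ρ • circlePoint (ω + γ) ∈ closedBall (0 : EuclideanSpace ℝ (Fin 2)) 1 :=
      convexHull_min (fun p hp => by simp [hs p hp]) (convex_closedBall _ _) hx
    simpa [norm_smul, norm_circlePoint, abs_of_pos hρ] using this
  rw [abs_lt] at hγ
  have hp' := abs_le.1 (hang p hp)
  have hq' := abs_le.1 (hang q hq)
  refine ⟨ρ, ω + ang p, ω + γ, ω + ang q, rfl, ?_, hball, ?_, ?_, by linarith,
    hpt p hp ▸ hp, hpt q hq ▸ hq⟩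
  · nlinarith [Real.cos_le_one γ]
  · have h := convexHull_subset_halfSpace (c := 0) (circlePoint (ω + ang p + Real.pi / 2))
      (fun y hy => by
        have hy' := abs_le.1 (hang y hy)
        have := hpmin y hy
        rw [hpt y hy, ← one_smul ℝ (circlePoint (ω + ang y)), inner_circlePoint_smul, one_mul]
        exact Real.cos_nonneg_of_mem_Icc ⟨by linarith, by linarith⟩) _ hx
    rw [inner_circlePoint_smul] at h
    by_contra! hlt
    have : Real.cos (ω + γ - (ω + ang p + Real.pi / 2)) < 0 := by
      rw [← Real.cos_neg]
      exact Real.cos_neg_of_pi_div_two_lt_of_lt (by linarith) (by linarith)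
    nlinarith
  · have h := convexHull_subset_halfSpace (c := 0) (circlePoint (ω + ang q - Real.pi / 2))
      (fun y hy => by
        have hy' := abs_le.1 (hang y hy)
        have := hqmax y hy
        rw [hpt y hy, ← one_smul ℝ (circlePoint (ω + ang y)), inner_circlePoint_smul, one_mul]
        exact Real.cos_nonneg_of_mem_Icc ⟨by linarith, by linarith⟩) _ hx
    rw [inner_circlePoint_smul] at h
    by_contra! hlt
    have : Real.cos (ω + γ - (ω + ang q - Real.pi / 2)) < 0 :=
      Real.cos_neg_of_pi_div_two_lt_of_lt (by linarith) (by linarith)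
    nlinarith

/-- Every angle lies between lifts of two cyclically consecutive sorted angles. -/
lemma exists_consecutive_lifts {n : ℕ} [NeZero n] {θ : Fin n → ℝ} (hθ : Monotone θ)
    (hrange : ∀ i, 0 ≤ θ i ∧ θ i < 2 * Real.pi) (α : ℝ) :
    ∃ (k : Fin n) (a b : ℝ), a ≤ α ∧ α < b ∧ circlePoint a = circlePoint (θ k) ∧
      circlePoint b = circlePoint (θ (k + 1)) ∧
      ∀ (i : Fin n) (l : ℤ), θ i + l * (2 * Real.pi) ∉ Ioo a b := by
  have hpi := Real.two_pi_pos
  suffices h : ∀ α, 0 ≤ α → α < 2 * Real.pi → ∃ (k : Fin n) (p q : ℤ),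
      θ k + p * (2 * Real.pi) ≤ α ∧ α < θ (k + 1) + q * (2 * Real.pi) ∧
      ∀ (i : Fin n) (l : ℤ), θ i + l * (2 * Real.pi) ∉
        Ioo (θ k + p * (2 * Real.pi)) (θ (k + 1) + q * (2 * Real.pi)) by
    obtain ⟨k, p, q, h1, h2, h3⟩ := h (toIcoMod hpi 0 α) (left_le_toIcoMod hpi 0 α)
      (by simpa using toIcoMod_lt_right hpi 0 α)
    set m := toIcoDiv hpi 0 α
    have hm : toIcoMod hpi 0 α + m * (2 * Real.pi) = α := by
      rw [← zsmul_eq_mul]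
      exact toIcoMod_add_toIcoDiv_zsmul hpi 0 α
    refine ⟨k, θ k + (p + m : ℤ) * (2 * Real.pi), θ (k + 1) + (q + m : ℤ) * (2 * Real.pi),
      ?_, ?_, circlePoint_add_int_mul_two_pi _ _, circlePoint_add_int_mul_two_pi _ _,
      fun i l hl => h3 i (l - m) ?_⟩
    · push_cast; linarith
    · push_cast; linarith
    · push_cast at hl ⊢
      exact ⟨by linarith [hl.1], by linarith [hl.2]⟩
  intro α h0 h1
  have hlift : ∀ (i : Fin n) (l : ℤ), l ≤ -1 ∧ θ i + l * (2 * Real.pi) ≤ θ i - 2 * Real.pi ∨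
      l = 0 ∨ 1 ≤ l ∧ θ i + 2 * Real.pi ≤ θ i + l * (2 * Real.pi) := by
    intro i l
    rcases lt_trichotomy l 0 with h | h | h
    · have h' : l ≤ -1 := by omega
      have : (l : ℝ) ≤ -1 := by exact_mod_cast h'
      exact Or.inl ⟨h', by nlinarith⟩
    · exact Or.inr (Or.inl h)
    · have h' : 1 ≤ l := by omega
      have : (1 : ℝ) ≤ l := by exact_mod_cast h'
      exact Or.inr (Or.inr ⟨h', by nlinarith⟩)
  obtain ⟨m, rfl⟩ := Nat.exists_eq_succ_of_ne_zero (NeZero.ne n)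
  by_cases hex : ∃ i, θ i ≤ α
  · obtain ⟨k, hk, hkmax⟩ := (Set.toFinite {i | θ i ≤ α}).exists_maximalFor id _ hex
    have hgt : ∀ i, k < i → α < θ i := fun i hi => by
      by_contra! h
      exact absurd (hkmax h hi.le) (not_le.2 hi)
    rcases eq_or_ne k (Fin.last m) with rfl | hkl
    · refine ⟨Fin.last m, 0, 1, by simpa using hk, ?_, fun i l hl => ?_⟩
      · push_cast
        linarith [(hrange (Fin.last m + 1)).1]
      · rw [Fin.last_add_one] at hl
        have := hθ (Fin.le_last i)
        have := hθ (Fin.zero_le i)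
        have := hrange i
        have := hrange (Fin.last m)
        have h3 := hl.1
        have h4 := hl.2
        push_cast at h3 h4
        rcases hlift i l with h | rfl | h
        · linarith
        · push_cast at h3; linarith
        · linarith
    · have hlt : k < k + 1 := Fin.lt_add_one_iff.2 (Fin.lt_last_iff_ne_last.2 hkl)
      refine ⟨k, 0, 0, by simpa using hk, by simpa using hgt _ hlt, fun i l hl => ?_⟩
      have h3 := hl.1
      have h4 := hl.2
      push_cast at h3 h4
      have := hrange i
      have := hrange k
      have := hrange (k + 1)
      rcases hlift i l with h | rfl | h
      · linarith
      · push_cast at h3 h4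
        rcases le_or_gt i k with hik | hik
        · linarith [hθ hik]
        · linarith [hθ (Fin.add_one_le_of_lt hik)]
      · linarith
  · push Not at hex
    refine ⟨Fin.last m, -1, 0, ?_, ?_, fun i l hl => ?_⟩
    · push_cast
      linarith [hrange (Fin.last m)]
    · simpa using hex _
    · rw [Fin.last_add_one] at hl
      have := hθ (Fin.le_last i)
      have := hθ (Fin.zero_le i)
      have := hrange i
      have := hrange 0
      have h3 := hl.1
      have h4 := hl.2
      push_cast at h3 h4
      rcases hlift i l with h | rfl | h
      · linarith
      · push_cast at h4; linarith
      · linarith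

lemma dist_smul_circlePoint_le {ρ α β φ δ : ℝ} (hφ : 0 ≤ Real.cos φ) (hρ : Real.cos φ ≤ ρ)
    (hρ₁ : ρ ≤ 1) (hδ : |α - β| ≤ δ) (hδφ : δ ≤ φ) (hφ₁ : φ < Real.pi / 2) :
    dist (ρ • circlePoint α) (circlePoint β) ≤ Real.sin δ + Real.sin φ ^ 2 := by
  have h0 := abs_nonneg (α - β)
  have hcos : Real.cos φ ≤ Real.cos (α - β) := by
    rw [← Real.cos_abs (α - β)]
    exact Real.cos_le_cos_of_nonneg_of_le_pi h0 (by linarith) (hδ.trans hδφ)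
  have hsin : |Real.sin (α - β)| ≤ Real.sin δ := by
    rw [Real.abs_sin_eq_sin_abs_of_abs_le_pi (by linarith)]
    exact Real.sin_le_sin_of_le_of_le_pi_div_two (by linarith) (by linarith) hδ
  have hdiff : |ρ - Real.cos (α - β)| ≤ Real.sin φ ^ 2 := by
    have h1 := Real.sin_sq_add_cos_sq φ
    have h2 := Real.cos_le_one φ
    have h3 := Real.cos_le_one (α - β)
    rw [abs_le]
    constructor <;> nlinarith
  calc dist (ρ • circlePoint α) (circlePoint β)
      ≤ |Real.sin (α - β)| + |ρ - Real.cos (α - β)| := by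
        refine le_of_sq_le_sq ?_ (by positivity)
        rw [dist_smul_circlePoint_sq, ← sq_abs (ρ - _), ← sq_abs (Real.sin _)]
        nlinarith [abs_nonneg (Real.sin (α - β)), abs_nonneg (ρ - Real.cos (α - β)),
          mul_nonneg (abs_nonneg (Real.sin (α - β))) (abs_nonneg (ρ - Real.cos (α - β)))]
    _ ≤ _ := add_le_add hsin hdiff

/-- A point in the hull of a part of the sample contained in a ball of radius `r < 1` is within
`gap + r ^ 2` of the sample, for some consecutive half-chord `gap ≤ r`, or within `r ^ 2`. -/
lemma exists_dist_le_of_mem_convexHull {n : ℕ} [NeZero n] {θ : Fin n → ℝ} (hθ : Monotone θ)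
    (hrange : ∀ i, 0 ≤ θ i ∧ θ i < 2 * Real.pi) {s : Set (EuclideanSpace ℝ (Fin 2))}
    (hs : s ⊆ range fun i => circlePoint (θ i)) {z : EuclideanSpace ℝ (Fin 2)} {r : ℝ}
    (hr : r < 1) (hz : s ⊆ closedBall z r) {x : EuclideanSpace ℝ (Fin 2)}
    (hx : x ∈ convexHull ℝ s) :
    ∃ i, dist x (circlePoint (θ i)) ≤ r ^ 2 ∨
      ∃ k, dist (circlePoint (θ (k + 1))) (circlePoint (θ k)) / 2 ≤ r ∧
        dist x (circlePoint (θ i)) ≤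
          dist (circlePoint (θ (k + 1))) (circlePoint (θ k)) / 2 + r ^ 2 := by
  obtain ⟨p, hp⟩ : s.Nonempty := convexHull_nonempty_iff.1 ⟨x, hx⟩
  have hr0 : 0 ≤ r := dist_nonneg.trans (hz hp)
  have hunit : ∀ p ∈ s, ‖p‖ = 1 := fun p hp => by
    obtain ⟨i, rfl⟩ := hs hp
    exact norm_circlePoint _
  obtain ⟨φ, hφ0, hφ1, rfl⟩ : ∃ φ, 0 ≤ φ ∧ φ < Real.pi / 2 ∧ Real.sin φ = r :=
    ⟨Real.arcsin r, Real.arcsin_nonneg.2 hr0, Real.arcsin_lt_pi_div_two.2 hr,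
      Real.sin_arcsin (by linarith) hr.le⟩
  have hcos : 0 < Real.cos φ := Real.cos_pos_of_mem_Ioo ⟨by linarith, hφ1⟩
  obtain ⟨ω, hω⟩ := exists_cap hunit hcos hz
  obtain ⟨ρ, lo, α, hi, rfl, hρ, hρ1, hlo, hhi, hw, hslo, hshi⟩ :=
    exists_sector ((Set.finite_range _).subset hs) hunit hφ0 hφ1 hω hx
  obtain ⟨k, a, b, haα, hαb, hak, hbk, hgap⟩ := exists_consecutive_lifts hθ hrange α
  have havoid : ∀ β, circlePoint β ∈ s → β ∉ Ioo a b := by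
    intro β hβ
    obtain ⟨i, hi⟩ := hs hβ
    have hang : (θ i : Real.Angle) = β := by
      apply Real.Angle.cos_sin_inj
      · simpa [circlePoint] using congrArg (fun v => v 0) hi
      · simpa [circlePoint] using congrArg (fun v => v 1) hi
    obtain ⟨m, hm⟩ := Real.Angle.angle_eq_iff_two_pi_dvd_sub.1 hang.symm
    rw [show β = θ i + m * (2 * Real.pi) by linarith]
    exact hgap i m
  have hloa : lo ≤ a := by
    by_contra! h
    exact havoid lo hslo ⟨h, hlo.trans_lt hαb⟩
  by_cases hib : b ≤ hi
  · have hd : dist (circlePoint (θ (k + 1))) (circlePoint (θ k)) / 2 = Real.sin ((b - a) / 2) := by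
      rw [← hak, ← hbk, dist_circlePoint (by linarith) (by linarith)]
      ring
    have hδφ : (b - a) / 2 ≤ φ := by linarith
    have hle : Real.sin ((b - a) / 2) ≤ Real.sin φ :=
      Real.sin_le_sin_of_le_of_le_pi_div_two (by linarith) hφ1.le hδφ
    rcases le_total (α - a) (b - α) with h | h
    · refine ⟨k, Or.inr ⟨k, hd.trans_le hle, ?_⟩⟩
      rw [hd, ← hak]
      exact dist_smul_circlePoint_le hcos.le hρ hρ1
        (by rw [abs_le]; constructor <;> linarith) hδφ hφ1
    · refine ⟨k + 1, Or.inr ⟨k, hd.trans_le hle, ?_⟩⟩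
      rw [hd, ← hbk]
      exact dist_smul_circlePoint_le hcos.le hρ hρ1
        (by rw [abs_le]; constructor <;> linarith) hδφ hφ1
  · have hhia : hi ≤ a := by
      by_contra! h
      exact havoid hi hshi ⟨h, not_le.1 hib⟩
    obtain rfl : α = a := by linarith
    refine ⟨k, Or.inl ?_⟩
    rw [← hak]
    simpa using dist_smul_circlePoint_le hcos.le hρ hρ1 (by simp : |α - α| ≤ 0) hφ0 hφ1

lemma subset_tConv {t : ℝ} (ht : 0 ≤ t) (A : Set (EuclideanSpace ℝ (Fin D))) :
    A ⊆ tConv t A := by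
  intro x hx
  refine mem_biUnion (x := {x}) ⟨singleton_subset_iff.2 hx, le_trans ?_ ht⟩ (by simp)
  refine csInf_le ⟨0, ?_⟩ ⟨x, by simp⟩
  rintro r ⟨z, hz⟩
  exact dist_nonneg.trans (hz rfl)

lemma exists_subset_closedBall_of_sebRadius_lt {s : Set (EuclideanSpace ℝ (Fin D))}
    (hs : Bornology.IsBounded s) {T : ℝ} (h : sebRadius s < T) :
    ∃ z, ∃ r < T, s ⊆ closedBall z r := by
  obtain ⟨R, hR⟩ := hs.subset_closedBall 0
  obtain ⟨r, ⟨z, hz⟩, hr⟩ := exists_lt_of_csInf_lt (by exact ⟨R, 0, hR⟩) h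
  exact ⟨z, r, hr, hz⟩

/-- For points `X₁, …, X_n` on the unit circle sorted by angle, with cyclic chord half-lengths
`gap i = |X_{i+1} − X_i|/2` ordered by a permutation `σ` (so `gap (σ 0) ≤ ⋯ ≤ gap (σ (n-1))`),
if `t ∈ [t_(i), t_(i+1))` then `h(t, 𝒳_n) ≤ t_(i) + t_(i+1)²`. -/
theorem circle_convDefect_bound {n : ℕ} [NeZero n]
    (X : Fin n → EuclideanSpace ℝ (Fin 2)) (θ : Fin n → ℝ)
    (hθmono : Monotone θ) (hθrange : ∀ i, 0 ≤ θ i ∧ θ i < 2 * Real.pi)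
    (hX : ∀ i, X i 0 = Real.cos (θ i) ∧ X i 1 = Real.sin (θ i))
    (gap : Fin n → ℝ) (hgap : ∀ i, gap i = dist (X (i + 1)) (X i) / 2)
    (σ : Equiv.Perm (Fin n)) (hsorted : Monotone fun i => gap (σ i))
    (i j : Fin n) (hij : (i : ℕ) + 1 = (j : ℕ))
    (t : ℝ) (ht1 : gap (σ i) ≤ t) (ht2 : t < gap (σ j)) :
    convDefect t (Set.range X) ≤ gap (σ i) + gap (σ j) ^ 2 := by
  obtain rfl : X = fun i => circlePoint (θ i) := by
    funext i
    ext l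
    fin_cases l
    · exact (hX i).1
    · exact (hX i).2
  have hgap0 : ∀ k, 0 ≤ gap k := fun k => by rw [hgap]; positivity
  have hgap1 : ∀ k, gap k ≤ 1 := fun k => by
    have := dist_le_norm_add_norm (circlePoint (θ (k + 1))) (circlePoint (θ k))
    rw [norm_circlePoint, norm_circlePoint] at this
    rw [hgap]
    linarith
  have hstep : ∀ k, gap k < gap (σ j) → gap k ≤ gap (σ i) := by
    intro k hk
    obtain ⟨l, rfl⟩ := σ.surjective k
    refine hsorted (Fin.le_def.2 ?_)
    have : l < j := by
      by_contra! h
      exact absurd (hsorted h) (not_le.2 hk)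
    rw [Fin.lt_def] at this
    omega
  have hbound : 0 ≤ gap (σ i) + gap (σ j) ^ 2 := add_nonneg (hgap0 _) (sq_nonneg _)
  refine hausdorffDist_le_of_mem_dist hbound ?_ fun x hx =>
    ⟨x, subset_tConv ((hgap0 _).trans ht1) _ hx, by rwa [dist_self]⟩
  intro x hx
  obtain ⟨s, ⟨hs, hst⟩, hxs⟩ := mem_iUnion₂.1 hx
  obtain ⟨z, r, hr, hz⟩ := exists_subset_closedBall_of_sebRadius_lt
    ((Set.finite_range _).isBounded.subset hs) (hst.trans_lt ht2)
  have hr0 : 0 ≤ r := by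
    obtain ⟨p, hp⟩ : s.Nonempty := convexHull_nonempty_iff.1 ⟨x, hxs⟩
    exact dist_nonneg.trans (hz hp)
  have hsq : r ^ 2 ≤ gap (σ j) ^ 2 := pow_le_pow_left₀ hr0 hr.le 2
  obtain ⟨l, hl⟩ := exists_dist_le_of_mem_convexHull hθmono hθrange hs
    (hr.trans_le (hgap1 _)) hz hxs
  refine ⟨circlePoint (θ l), mem_range_self l, ?_⟩
  rcases hl with hl | ⟨k, hk, hl⟩
  · linarith [hgap0 (σ i)]
  · rw [← hgap k] at hk hl
    linarith [hstep k (hk.trans_lt hr)]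
end
end
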